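/- Let n ≥ 2, s ∈ (0,1), α > 0, and let μ_{n,s} > 0 be defined by μ_{n,s}^{−1} = inf{ P(E)^s / (s(1−s) P_s(E)) : E ⊆ ℝⁿ of finite perimeter with |E| = 1 }. Then, as m → ∞, inf{ F_{s,α}(F) : |F| = m } = inf{ G_{s,α}(𝔽) : |𝔽| = m } = −(1−s)·s^{s/(1−s)}·(α μ_{n,s})^{1/(1−s)}·m + o(m); equivalently, (1/m)·inf{ F_{s,α}(F) : |F| = m } converges to −(1−s) s^{s/(1−s)} (α μ_{n,s})^{1/(1−s)} as m → ∞, and the same limit holds for (1/m)·inf{ G_{s,α}(𝔽) : |𝔽| = m }. -/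

import Mathlib

open MeasureTheory Metric Set Filter
open scoped ENNReal Pointwise symmDiff Classical

noncomputable section

abbrev Euc (n : ℕ) := EuclideanSpace ℝ (Fin n)

/-- Divergence of a vector field on ℝⁿ. -/
def divg {n : ℕ} (g : Euc n → Euc n) (x : Euc n) : ℝ :=
  ∑ i : Fin n, fderiv ℝ g x (EuclideanSpace.single i 1) i

/-- The admissible values in the variational definition of the perimeter:
values `∫_E div g` over C¹ compactly supported vector fields with `‖g‖ ≤ 1`. -/
def perimVals {n : ℕ} (E : Set (Euc n)) : Set ℝ :=
  {r | ∃ g : Euc n → Euc n, ContDiff ℝ 1 g ∧ HasCompactSupport g ∧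
        (∀ x, ‖g x‖ ≤ 1) ∧ r = ∫ x in E, divg g x}

/-- Perimeter: total variation of the characteristic function. -/
def perim {n : ℕ} (E : Set (Euc n)) : ℝ := sSup (perimVals E)

/-- A set has finite perimeter if the variational quantities are bounded above. -/
def HasFinitePerim {n : ℕ} (E : Set (Euc n)) : Prop := BddAbove (perimVals E)

/-- Characteristic function of a set. -/
def chi {n : ℕ} (E : Set (Euc n)) : Euc n → ℝ := E.indicator 1

/-- Nonlocal perimeter associated with a kernel `K`. -/
def PK {n : ℕ} (K : Euc n → ℝ) (E : Set (Euc n)) : ℝ :=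
  ∫ x, ∫ y, K (x - y) * |chi E x - chi E y|

/-- Fractional `s`-perimeter. -/
def Ps (n : ℕ) (s : ℝ) (E : Set (Euc n)) : ℝ :=
  ∫ x : Euc n, ∫ y : Euc n, |chi E x - chi E y| / ‖x - y‖ ^ ((n : ℝ) + s)

/-- The energy `J_α(E) = P(E) - α s (1-s) P_K(E)`. -/
def Jen {n : ℕ} (K : Euc n → ℝ) (s α : ℝ) (E : Set (Euc n)) : ℝ :=
  perim E - α * s * (1 - s) * PK K E

/-- The energy `F_{s,α}(E) = P(E) - α s (1-s) P_s(E)`. -/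
def Fen (n : ℕ) (s α : ℝ) (E : Set (Euc n)) : ℝ :=
  perim E - α * s * (1 - s) * Ps n s E

/-- ω_n : volume of the unit ball of ℝⁿ. -/
def ballVol (n : ℕ) : ℝ := (volume (ball (0 : Euc n) 1)).toReal

/-- Volume-constrained global minimizer of `J_α` (volume `m`). -/
def IsJMin {n : ℕ} (K : Euc n → ℝ) (s α m : ℝ) (E : Set (Euc n)) : Prop :=
  MeasurableSet E ∧ HasFinitePerim E ∧ volume E = ENNReal.ofReal m ∧
    ∀ F : Set (Euc n), MeasurableSet F → HasFinitePerim F →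
      volume F = ENNReal.ofReal m → Jen K s α E ≤ Jen K s α F

/-- Volume-constrained global minimizer of `F_{s,α}` (volume `m`). -/
def IsFMin (n : ℕ) (s α m : ℝ) (E : Set (Euc n)) : Prop :=
  MeasurableSet E ∧ HasFinitePerim E ∧ volume E = ENNReal.ofReal m ∧
    ∀ F : Set (Euc n), MeasurableSet F → HasFinitePerim F →
      volume F = ENNReal.ofReal m → Fen n s α E ≤ Fen n s α F

/-- A finite family of admissible sets. -/
def FamOK {n N : ℕ} (𝔼 : Fin N → Set (Euc n)) : Prop :=
  ∀ i, MeasurableSet (𝔼 i) ∧ HasFinitePerim (𝔼 i) ∧ volume (𝔼 i) ≠ ∞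

/-- Total volume of a finite family. -/
def famVol {n N : ℕ} (𝔼 : Fin N → Set (Euc n)) : ℝ≥0∞ := ∑ i, volume (𝔼 i)

/-- Generalized (interaction-free) energy `G_α` for the kernel `K`. -/
def GenJ {n N : ℕ} (K : Euc n → ℝ) (s α : ℝ) (𝔼 : Fin N → Set (Euc n)) : ℝ :=
  ∑ i, Jen K s α (𝔼 i)

/-- Generalized (interaction-free) energy `G_{s,α}` for the fractional kernel. -/
def GenF (n : ℕ) (s α : ℝ) {N : ℕ} (𝔼 : Fin N → Set (Euc n)) : ℝ :=
  ∑ i, Fen n s α (𝔼 i)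

/-- Global minimizer of `G_α` (over families of arbitrary finite size) with total mass `m`. -/
def IsGJMin {n : ℕ} (K : Euc n → ℝ) (s α m : ℝ) {N : ℕ} (𝔼 : Fin N → Set (Euc n)) : Prop :=
  FamOK 𝔼 ∧ famVol 𝔼 = ENNReal.ofReal m ∧
    ∀ (M : ℕ) (𝔽 : Fin M → Set (Euc n)), FamOK 𝔽 → famVol 𝔽 = ENNReal.ofReal m →
      GenJ K s α 𝔼 ≤ GenJ K s α 𝔽

/-- Global minimizer of `G_{s,α}` (over families of arbitrary finite size) with total mass `m`. -/
def IsGFMin (n : ℕ) (s α m : ℝ) {N : ℕ} (𝔼 : Fin N → Set (Euc n)) : Prop :=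
  FamOK 𝔼 ∧ famVol 𝔼 = ENNReal.ofReal m ∧
    ∀ (M : ℕ) (𝔽 : Fin M → Set (Euc n)), FamOK 𝔽 → famVol 𝔽 = ENNReal.ofReal m →
      GenF n s α 𝔼 ≤ GenF n s α 𝔽

/-- Infimum of `F_{s,α}` over single sets of volume `m`. -/
def infF (n : ℕ) (s α m : ℝ) : ℝ :=
  sInf {r : ℝ | ∃ F : Set (Euc n), MeasurableSet F ∧ HasFinitePerim F ∧
    volume F = ENNReal.ofReal m ∧ r = Fen n s α F}

/-- Infimum of `G_{s,α}` over finite families of total volume `m`. -/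
def infG (n : ℕ) (s α m : ℝ) : ℝ :=
  sInf {r : ℝ | ∃ (N : ℕ) (𝔽 : Fin N → Set (Euc n)), FamOK 𝔽 ∧
    famVol 𝔽 = ENNReal.ofReal m ∧ r = GenF n s α 𝔽}

/-- Admissible vector fields. -/
def Adm {n : ℕ} (g : Euc n → Euc n) : Prop :=
  ContDiff ℝ 1 g ∧ HasCompactSupport g ∧ (∀ x, ‖g x‖ ≤ 1)

/-- Perimeter bound. -/
def PB {n : ℕ} (E : Set (Euc n)) (C : ℝ) : Prop :=
  ∀ g : Euc n → Euc n, Adm g → ∫ x in E, divg g x ≤ C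

lemma adm_zero {n : ℕ} : Adm (fun _ : Euc n => (0 : Euc n)) :=
  ⟨contDiff_const, HasCompactSupport.zero, by simp⟩

lemma divg_zero {n : ℕ} (x : Euc n) : divg (fun _ : Euc n => (0 : Euc n)) x = 0 := by
  simp [divg]

lemma zero_mem_perimVals {n : ℕ} (E : Set (Euc n)) : (0 : ℝ) ∈ perimVals E :=
  ⟨fun _ => 0, adm_zero.1, adm_zero.2.1, adm_zero.2.2, by simp [divg_zero]⟩

lemma PB_perim {n : ℕ} {E : Set (Euc n)} (h : HasFinitePerim E) : PB E (perim E) :=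
  fun g hg => le_csSup h ⟨g, hg.1, hg.2.1, hg.2.2, rfl⟩

lemma PB.fin {n : ℕ} {E : Set (Euc n)} {C : ℝ} (h : PB E C) : HasFinitePerim E := by
  refine ⟨C, ?_⟩
  rintro r ⟨g, h1, h2, h3, rfl⟩
  exact h g ⟨h1, h2, h3⟩

lemma PB.le {n : ℕ} {E : Set (Euc n)} {C : ℝ} (h : PB E C) : perim E ≤ C := by
  refine csSup_le ⟨0, zero_mem_perimVals E⟩ ?_
  rintro r ⟨g, h1, h2, h3, rfl⟩
  exact h g ⟨h1, h2, h3⟩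

lemma perim_nonneg {n : ℕ} {E : Set (Euc n)} (h : HasFinitePerim E) : 0 ≤ perim E :=
  le_csSup h (zero_mem_perimVals E)

lemma PB_null {n : ℕ} {E : Set (Euc n)} (h : volume E = 0) : PB E 0 := by
  intro g _
  rw [Measure.restrict_eq_zero.2 h]; simp

lemma divg_continuous {n : ℕ} {g : Euc n → Euc n} (hg : ContDiff ℝ 1 g) : Continuous (divg g) := by
  unfold divg
  have h : Continuous (fderiv ℝ g) := hg.continuous_fderiv (by simp)
  fun_prop

lemma divg_hcs {n : ℕ} {g : Euc n → Euc n} (hg : HasCompactSupport g) :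
    HasCompactSupport (divg g) := by
  have h := hg.fderiv (𝕜 := ℝ)
  refine h.mono ?_
  intro x hx hx'
  apply hx
  simp [divg, hx']

lemma divg_integrable {n : ℕ} {g : Euc n → Euc n} (hg : Adm g) : Integrable (divg g) :=
  (divg_continuous hg.1).integrable_of_hasCompactSupport (divg_hcs hg.2.1)

/-- change of variables for the map `y ↦ a • y + b` -/
lemma integral_aff {n : ℕ} {a : ℝ} (ha : 0 < a) (b : Euc n) (f : Euc n → ℝ) :
    ∫ x, f (a • x + b) = (a ^ n)⁻¹ * ∫ x, f x := by
  have h1 := Measure.integral_comp_smul (volume : Measure (Euc n)) (fun x => f (x + b)) a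
  rw [h1, integral_add_right_eq_self f b]
  simp [abs_of_pos ha]

lemma divg_comp_aff {n : ℕ} {g : Euc n → Euc n} (hg : ContDiff ℝ 1 g) (a : ℝ) (b : Euc n)
    (x : Euc n) : divg (fun y => g (a • y + b)) x = a * divg g (a • x + b) := by
  have hd : DifferentiableAt ℝ g (a • x + b) := hg.differentiable (by simp) _
  have h2 : HasFDerivAt (fun y : Euc n => a • y + b) (a • ContinuousLinearMap.id ℝ (Euc n)) x :=
    ((hasFDerivAt_id x).const_smul a).add_const b
  have h3 := (hd.hasFDerivAt.comp x h2).fderiv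
  have h4 : (g ∘ fun y : Euc n => a • y + b) = (fun y => g (a • y + b)) := rfl
  rw [h4] at h3
  unfold divg
  rw [h3, Finset.mul_sum]
  simp

lemma Adm.aff {n : ℕ} {g : Euc n → Euc n} (hg : Adm g) {a : ℝ} (ha : 0 < a) (b : Euc n) :
    Adm (fun y => g (a • y + b)) := by
  refine ⟨hg.1.comp (by fun_prop), ?_, fun x => hg.2.2 _⟩
  exact hg.2.1.comp_homeomorph ((Homeomorph.smulOfNeZero a ha.ne').trans (Homeomorph.addRight b))

lemma PB.aff {n : ℕ} (hn : 1 ≤ n) {E : Set (Euc n)} (hE : MeasurableSet E) {C : ℝ} (h : PB E C)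
    {a : ℝ} (ha : 0 < a) (b : Euc n) :
    PB ((fun y => a • y + b) ⁻¹' E) ((a ^ (n - 1))⁻¹ * C) := by
  intro g hg
  have hm : Measurable (fun y : Euc n => a • y + b) := by fun_prop
  set k : Euc n → Euc n := fun y => g (a⁻¹ • y + (-(a⁻¹ • b))) with hk
  have hkA : Adm k := hg.aff (inv_pos.2 ha) _
  have e1 : ∀ x, divg g x = a * divg k (a • x + b) := by
    intro x
    rw [hk, divg_comp_aff hg.1]
    rw [smul_add, inv_smul_smul₀ ha.ne', add_neg_cancel_right, mul_inv_cancel_left₀ ha.ne']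
  have e2 : ∫ x in (fun y => a • y + b) ⁻¹' E, divg g x =
      ∫ x, (fun z => a * E.indicator (divg k) z) (a • x + b) := by
    rw [← integral_indicator (hm hE)]
    congr 1; ext x
    by_cases hx : a • x + b ∈ E
    · rw [indicator_of_mem (by exact hx)]; simp [hx, e1 x]
    · rw [indicator_of_notMem (by exact hx)]; simp [hx]
  rw [e2, integral_aff ha b (fun z => a * E.indicator (divg k) z), integral_const_mul,
    integral_indicator hE]
  have e3 : (a ^ n)⁻¹ * (a * ∫ x in E, divg k x) = (a ^ (n-1))⁻¹ * ∫ x in E, divg k x := by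
    obtain ⟨m, rfl⟩ : ∃ m, n = m + 1 := ⟨n - 1, by omega⟩
    simp only [Nat.add_sub_cancel, pow_succ]
    field_simp
  rw [e3]
  exact mul_le_mul_of_nonneg_left (h k hkA) (by positivity)

lemma volume_aff {n : ℕ} (E : Set (Euc n)) {a : ℝ} (ha : 0 < a) (b : Euc n) :
    volume ((fun y => a • y + b) ⁻¹' E) = ENNReal.ofReal ((a ^ n)⁻¹) * volume E := by
  have : (fun y : Euc n => a • y + b) ⁻¹' E = (fun y : Euc n => a • y) ⁻¹' ((fun y => y + b) ⁻¹' E) :=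
    rfl
  rw [this, Measure.addHaar_preimage_smul _ ha.ne', measure_preimage_add_right]
  simp [abs_of_pos ha]

lemma Ps_aff {n : ℕ} (s : ℝ) (E : Set (Euc n)) {a : ℝ} (ha : 0 < a) (b : Euc n) :
    Ps n s ((fun y => a • y + b) ⁻¹' E) = a ^ (s - n) * Ps n s E := by
  unfold Ps
  have e1 : ∀ x y : Euc n, |chi ((fun y => a • y + b) ⁻¹' E) x - chi ((fun y => a • y + b) ⁻¹' E) y| /
      ‖x - y‖ ^ ((n : ℝ) + s) = a ^ ((n : ℝ) + s) * (|chi E (a • x + b) - chi E (a • y + b)| /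
      ‖(a • x + b) - (a • y + b)‖ ^ ((n : ℝ) + s)) := by
    intro x y
    have : (a • x + b) - (a • y + b) = a • (x - y) := by rw [smul_sub]; abel
    rw [this, norm_smul, Real.norm_of_nonneg ha.le, Real.mul_rpow ha.le (norm_nonneg _)]
    have h0 : a ^ ((n : ℝ) + s) ≠ 0 := (Real.rpow_pos_of_pos ha _).ne'
    have h1 : ∀ z, chi ((fun y => a • y + b) ⁻¹' E) z = chi E (a • z + b) := fun z => rfl
    rw [h1, h1]
    rw [mul_div_assoc', mul_div_mul_left _ _ h0]
  simp_rw [e1, integral_const_mul]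
  have e2 : ∀ x : Euc n, ∫ y, |chi E (a • x + b) - chi E (a • y + b)| /
      ‖(a • x + b) - (a • y + b)‖ ^ ((n : ℝ) + s) = (a ^ n)⁻¹ * ∫ y, |chi E (a • x + b) - chi E y| /
      ‖(a • x + b) - y‖ ^ ((n : ℝ) + s) := fun x =>
    integral_aff ha b (fun y => |chi E (a • x + b) - chi E y| / ‖(a • x + b) - y‖ ^ ((n : ℝ) + s))
  simp_rw [e2, integral_const_mul]
  rw [integral_aff ha b (fun x => ∫ y, |chi E x - chi E y| / ‖x - y‖ ^ ((n : ℝ) + s))]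
  rw [Real.rpow_sub ha, Real.rpow_add ha, Real.rpow_natCast]
  field_simp

/-- Bump functions shrinking to the origin. -/
def bmp (n k : ℕ) : ContDiffBump (0 : Euc n) where
  rIn := 1 / ((k : ℝ) + 1)
  rOut := 2 / ((k : ℝ) + 1)
  rIn_pos := by positivity
  rIn_lt_rOut := by gcongr; norm_num

/-- Mollification. -/
def moll {n : ℕ} (k : ℕ) (f : Euc n → ℝ) : Euc n → ℝ :=
  fun x => MeasureTheory.convolution ((bmp n k).normed volume) f (ContinuousLinearMap.lsmul ℝ ℝ)
    volume x

lemma moll_apply {n : ℕ} (k : ℕ) (f : Euc n → ℝ) (x : Euc n) :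
    moll k f x = ∫ t, (bmp n k).normed volume t * f (x - t) := by
  simp [moll, convolution_def]

lemma loc_int {n : ℕ} {f : Euc n → ℝ} (hf : Measurable f) (hb : ∀ x, |f x| ≤ 1) :
    LocallyIntegrable f := by
  refine (locallyIntegrable_const (1 : ℝ)).mono hf.aestronglyMeasurable ?_
  exact Eventually.of_forall fun x => by simpa using hb x

lemma moll_contDiff {n : ℕ} (k : ℕ) {f : Euc n → ℝ} (hf : Measurable f) (hb : ∀ x, |f x| ≤ 1) :
    ContDiff ℝ 1 (moll k f) := by
  have := HasCompactSupport.contDiff_convolution_left (n := 1) (ContinuousLinearMap.lsmul ℝ ℝ)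
    ((bmp n k).hasCompactSupport_normed (μ := volume)) ((bmp n k).contDiff_normed) (loc_int hf hb)
  exact this

lemma moll_int {n : ℕ} (k : ℕ) {f : Euc n → ℝ} (hf : Measurable f) (hb : ∀ x, |f x| ≤ 1)
    (x : Euc n) : Integrable (fun t => (bmp n k).normed volume t * f (x - t)) := by
  refine ((bmp n k).integrable_normed (μ := volume)).mono' ?_ ?_
  · exact ((bmp n k).continuous_normed.measurable.mul (hf.comp (by fun_prop))).aestronglyMeasurable
  · refine Eventually.of_forall fun t => ?_
    have h0 := (bmp n k).nonneg_normed (μ := volume) t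
    rw [norm_mul, Real.norm_of_nonneg h0]
    exact mul_le_of_le_one_right h0 (hb _)

lemma moll_abs_le {n : ℕ} (k : ℕ) {f : Euc n → ℝ} (hb : ∀ x, |f x| ≤ 1)
    (x : Euc n) : |moll k f x| ≤ 1 := by
  rw [moll_apply, ← (bmp n k).integral_normed (μ := volume), ← Real.norm_eq_abs]
  refine norm_integral_le_of_norm_le ((bmp n k).integrable_normed) ?_
  refine Eventually.of_forall fun t => ?_
  have h0 := (bmp n k).nonneg_normed (μ := volume) t
  rw [norm_mul, Real.norm_of_nonneg h0]
  exact mul_le_of_le_one_right h0 (hb _)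

lemma moll_nonneg {n : ℕ} (k : ℕ) {f : Euc n → ℝ} (hb : ∀ x, 0 ≤ f x)
    (x : Euc n) : 0 ≤ moll k f x := by
  rw [moll_apply]
  exact integral_nonneg fun t => mul_nonneg ((bmp n k).nonneg_normed _) (hb _)

lemma moll_tendsto {n : ℕ} {f : Euc n → ℝ} (hf : Measurable f) (hb : ∀ x, |f x| ≤ 1) :
    ∀ᵐ x, Tendsto (fun k => moll k f x) atTop (nhds (f x)) := by
  refine ContDiffBump.ae_convolution_tendsto_right_of_locallyIntegrable (φ := fun k => bmp n k)
    (K := 2) ?_ ?_ (loc_int hf hb)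
  · have := (tendsto_one_div_add_atTop_nhds_zero_nat (𝕜 := ℝ)).const_mul 2
    simp only [mul_zero] at this
    refine this.congr fun k => ?_
    simp only [bmp]; ring
  · refine Eventually.of_forall fun k => ?_
    simp only [bmp]
    exact le_of_eq (by ring)

lemma chi_meas {n : ℕ} {E : Set (Euc n)} (hE : MeasurableSet E) : Measurable (chi E) :=
  measurable_one.indicator hE

lemma chi_cases {n : ℕ} (E : Set (Euc n)) (x : Euc n) : chi E x = 0 ∨ chi E x = 1 := by
  by_cases h : x ∈ E <;> simp [chi, h]

lemma chi_nonneg {n : ℕ} (E : Set (Euc n)) (x : Euc n) : 0 ≤ chi E x := by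
  rcases chi_cases E x with h | h <;> simp [h]

lemma chi_le {n : ℕ} (E : Set (Euc n)) (x : Euc n) : chi E x ≤ 1 := by
  rcases chi_cases E x with h | h <;> simp [h]

lemma chi_abs {n : ℕ} (E : Set (Euc n)) (x : Euc n) : |chi E x| ≤ 1 := by
  rcases chi_cases E x with h | h <;> simp [h]

lemma chi_mul_int {n : ℕ} {E : Set (Euc n)} (hE : MeasurableSet E) (f : Euc n → ℝ) :
    ∫ x, chi E x * f x = ∫ x in E, f x := by
  rw [← integral_indicator hE]
  congr 1; ext x
  by_cases h : x ∈ E <;> simp [chi, h]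

lemma moll_PB {n : ℕ} (k : ℕ) {E : Set (Euc n)} (hE : MeasurableSet E) {C : ℝ} (h : PB E C)
    {g : Euc n → Euc n} (hg : Adm g) : ∫ x, moll k (chi E) x * divg g x ≤ C := by
  set φ := (bmp n k).normed (volume : Measure (Euc n)) with hφ
  have hφi : Integrable φ := (bmp n k).integrable_normed
  have hφ0 : ∀ t, 0 ≤ φ t := (bmp n k).nonneg_normed
  have hφm : Measurable φ := (bmp n k).continuous_normed.measurable
  have hdm : Measurable (divg g) := (divg_continuous hg.1).measurable
  have hχ := chi_meas hE
  have hint : Integrable (Function.uncurry fun (x t : Euc n) => φ t * chi E (x - t) * divg g x)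
      (volume.prod volume) := by
    refine ((divg_integrable hg).mul_prod hφi).mono ?_ ?_
    · apply Measurable.aestronglyMeasurable
      simp only [Function.uncurry_def]
      fun_prop
    · refine Eventually.of_forall fun p => ?_
      simp only [Function.uncurry, norm_mul]
      rw [Real.norm_eq_abs (chi E _), mul_comm ‖divg g p.1‖]
      gcongr
      exact mul_le_of_le_one_right (norm_nonneg _) (chi_abs _ _)
  have e1 : ∫ x, moll k (chi E) x * divg g x = ∫ x, ∫ t, φ t * chi E (x - t) * divg g x := by
    congr 1; ext x
    rw [moll_apply, integral_mul_const]
  have e2 : ∀ t, ∫ x, φ t * chi E (x - t) * divg g x =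
      φ t * ∫ x in E, divg (fun y => g ((1:ℝ) • y + t)) x := by
    intro t
    simp_rw [mul_assoc]
    rw [integral_const_mul, ← chi_mul_int hE,
      ← integral_add_right_eq_self (fun x => chi E (x - t) * divg g x) t]
    simp_rw [divg_comp_aff hg.1]
    simp
  rw [e1, integral_integral_swap hint]
  simp_rw [e2]
  have hC : ∫ t, φ t * C = C := by
    rw [integral_mul_const, hφ, (bmp n k).integral_normed, one_mul]
  rw [← hC]
  refine integral_mono ?_ (hφi.mul_const _) ?_
  · have := hint.integral_prod_right
    simp only [Function.uncurry] at this
    simpa only [e2] using this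
  · intro t
    exact mul_le_mul_of_nonneg_left (h _ (hg.aff one_pos t)) (hφ0 t)

lemma divg_smul {n : ℕ} {w : Euc n → ℝ} {g : Euc n → Euc n} (hw : ContDiff ℝ 1 w)
    (hg : ContDiff ℝ 1 g) (x : Euc n) :
    divg (fun y => w y • g y) x = w x * divg g x + fderiv ℝ w x (g x) := by
  have h1 : DifferentiableAt ℝ w x := hw.differentiable (by simp) x
  have h2 : DifferentiableAt ℝ g x := hg.differentiable (by simp) x
  unfold divg
  rw [fderiv_fun_smul h1 h2]
  have h3 : g x = ∑ i, g x i • EuclideanSpace.single i (1:ℝ) := by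
    ext j; simp [Finset.sum_apply, Pi.single_apply]
  conv_rhs => rw [h3]
  simp [Finset.sum_add_distrib, Finset.mul_sum, mul_comm]

lemma integral_divg {n : ℕ} {g : Euc n → Euc n} (hg : ContDiff ℝ 1 g) (hc : HasCompactSupport g) :
    ∫ x, divg g x = 0 := by
  have hcd : Continuous (fderiv ℝ g) := hg.continuous_fderiv (by simp)
  have hi : ∀ i : Fin n, Integrable (fun x => fderiv ℝ g x (EuclideanSpace.single i 1) i) := by
    intro i
    refine Continuous.integrable_of_hasCompactSupport (by fun_prop) ?_
    refine (hc.fderiv (𝕜 := ℝ)).mono ?_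
    intro x hx hx'
    apply hx
    simp [hx']
  unfold divg
  rw [integral_finsetSum _ (fun i _ => hi i)]
  refine Finset.sum_eq_zero fun i _ => ?_
  have hd : Differentiable ℝ g := hg.differentiable (by simp)
  have e : ∀ x, fderiv ℝ (fun y => g y i) x (EuclideanSpace.single i 1) =
      fderiv ℝ g x (EuclideanSpace.single i 1) i := by
    intro x
    have := ((EuclideanSpace.proj (𝕜 := ℝ) i).hasFDerivAt.comp x (hd x).hasFDerivAt).fderiv
    have h4 : ((EuclideanSpace.proj (𝕜 := ℝ) i : Euc n →L[ℝ] ℝ) ∘ g) = (fun y => g y i) := rfl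
    rw [h4] at this
    rw [this]; simp
  have hgi : Integrable (fun y => g y i) := by
    refine Continuous.integrable_of_hasCompactSupport (by have := hg.continuous; fun_prop) ?_
    refine hc.mono ?_
    intro x hx hx'
    apply hx
    simp [hx']
  have := integral_mul_fderiv_eq_neg_fderiv_mul_of_integrable (μ := (volume : Measure (Euc n)))
    (f := fun _ => (1:ℝ)) (g := fun y => g y i) (v := EuclideanSpace.single i 1) (𝕜 := ℝ)
    (by simp) (by simpa [e] using hi i) (by simpa using hgi) (by fun_prop)
    (by fun_prop)
  simpa [e] using this

lemma Adm.smul {n : ℕ} {g : Euc n → Euc n} (hg : Adm g) {w : Euc n → ℝ} (hw : ContDiff ℝ 1 w)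
    (h1 : ∀ x, |w x| ≤ 1) : Adm (fun y => w y • g y) := by
  refine ⟨hw.smul hg.1, ?_, fun x => ?_⟩
  · refine hg.2.1.mono ?_
    intro x hx hx'
    apply hx
    simp [hx']
  rw [norm_smul]
  exact mul_le_one₀ (h1 x) (norm_nonneg _) (hg.2.2 x)

lemma PB.union {n : ℕ} {A B : Set (Euc n)} (hA : MeasurableSet A) (hB : MeasurableSet B)
    {C D : ℝ} (hAC : PB A C) (hBD : PB B D) : PB (A ∪ B) (C + D) := by
  intro g hg
  have hdi := divg_integrable hg
  have hdm : Measurable (divg g) := (divg_continuous hg.1).measurable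
  have ca := fun k => moll_contDiff (f := chi A) k (chi_meas hA) (chi_abs A)
  have cb := fun k => moll_contDiff (f := chi B) k (chi_meas hB) (chi_abs B)
  have ba := fun k => moll_abs_le k (chi_abs A)
  have bb := fun k => moll_abs_le k (chi_abs B)
  have na := fun k => moll_nonneg k (chi_nonneg A)
  have nb := fun k => moll_nonneg k (chi_nonneg B)
  have key : ∀ k, ∫ x, (moll k (chi A) x + moll k (chi B) x - moll k (chi A) x * moll k (chi B) x)
      * divg g x ≤ C + D := by
    intro k
    specialize ca k; specialize cb k; specialize ba k; specialize bb k
    specialize na k; specialize nb k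
    have hPA : ∀ f : Euc n → Euc n, Adm f → ∫ x, moll k (chi A) x * divg f x ≤ C :=
      fun f hf => moll_PB k hA hAC hf
    have hPB : ∀ f : Euc n → Euc n, Adm f → ∫ x, moll k (chi B) x * divg f x ≤ D :=
      fun f hf => moll_PB k hB hBD hf
    generalize moll k (chi A) = u at *
    generalize moll k (chi B) = v at *
    have au : Adm (fun y => (1 - v y) • g y) := hg.smul (by fun_prop) fun x => by
      rw [abs_le]; have := abs_le.1 (bb x); constructor <;> linarith [nb x]
    have av : Adm (fun y => (1 - u y) • g y) := hg.smul (by fun_prop) fun x => by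
      rw [abs_le]; have := abs_le.1 (ba x); constructor <;> linarith [na x]
    have auv : Adm (fun y => (u y * v y) • g y) := hg.smul (by fun_prop) fun x => by
      rw [abs_mul]; exact mul_le_one₀ (ba x) (abs_nonneg _) (bb x)
    have e : ∀ x, (u x + v x - u x * v x) * divg g x = u x * divg (fun y => (1 - v y) • g y) x +
        v x * divg (fun y => (1 - u y) • g y) x + divg (fun y => (u y * v y) • g y) x := by
      intro x
      rw [divg_smul (by fun_prop) hg.1, divg_smul (by fun_prop) hg.1, divg_smul (by fun_prop) hg.1]
      have du : DifferentiableAt ℝ u x := ca.differentiable (by simp) x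
      have dv : DifferentiableAt ℝ v x := cb.differentiable (by simp) x
      rw [fderiv_fun_mul du dv, fderiv_const_sub, fderiv_const_sub]
      simp
      ring
    have iu : Integrable (fun x => u x * divg (fun y => (1 - v y) • g y) x) := by
      refine (divg_integrable au).bdd_mul (c := 1) ca.continuous.aestronglyMeasurable ?_
      exact Eventually.of_forall ba
    have iv : Integrable (fun x => v x * divg (fun y => (1 - u y) • g y) x) := by
      refine (divg_integrable av).bdd_mul (c := 1) cb.continuous.aestronglyMeasurable ?_
      exact Eventually.of_forall bb
    simp_rw [e]
    have iuv : Integrable (fun x => u x * divg (fun y => (1 - v y) • g y) x +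
        v x * divg (fun y => (1 - u y) • g y) x) := iu.add iv
    rw [integral_add iuv (divg_integrable auv), integral_add iu iv,
      integral_divg auv.1 auv.2.1]
    linarith [hPA _ au, hPB _ av]
  have hlim : Tendsto (fun k => ∫ x, (moll k (chi A) x + moll k (chi B) x -
      moll k (chi A) x * moll k (chi B) x) * divg g x) atTop
      (nhds (∫ x, (chi A x + chi B x - chi A x * chi B x) * divg g x)) := by
    refine tendsto_integral_of_dominated_convergence (fun x => 3 * ‖divg g x‖) ?_
      (hdi.norm.const_mul 3) ?_ ?_
    · intro k
      have h1 := (ca k).continuous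
      have h2 := (cb k).continuous
      have h3 := (divg_continuous hg.1)
      exact Continuous.aestronglyMeasurable (by fun_prop)
    · intro k
      refine Eventually.of_forall fun x => ?_
      rw [norm_mul]
      gcongr
      have h1 := ba k x
      have h2 := bb k x
      have h3 : |moll k (chi A) x * moll k (chi B) x| ≤ 1 := by
        rw [abs_mul]; exact mul_le_one₀ h1 (abs_nonneg _) h2
      rw [Real.norm_eq_abs]
      rw [abs_le] at *
      constructor <;> linarith [h1.1, h1.2, h2.1, h2.2, h3.1, h3.2]
    · filter_upwards [moll_tendsto (chi_meas hA) (chi_abs A), moll_tendsto (chi_meas hB) (chi_abs B)]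
        with x h1 h2
      exact ((h1.add h2).sub (h1.mul h2)).mul_const _
  have e3 : ∫ x in A ∪ B, divg g x = ∫ x, (chi A x + chi B x - chi A x * chi B x) * divg g x := by
    rw [← chi_mul_int (hA.union hB)]
    congr 1; ext x
    by_cases h1 : x ∈ A <;> by_cases h2 : x ∈ B <;> simp [chi, h1, h2]
  rw [e3]
  exact le_of_tendsto hlim (Eventually.of_forall key)

lemma trans_smooth {n : ℕ} {E : Set (Euc n)} {C : ℝ} (hC : PB E C)
    {ψ : Euc n → ℝ} (h1 : ContDiff ℝ 1 ψ) (h2 : HasCompactSupport ψ) (h3 : ∀ x, |ψ x| ≤ 1)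
    (h : Euc n) : ∫ x in E, (ψ (x - h) - ψ x) ≤ ‖h‖ * C := by
  have hcd : Continuous (fderiv ℝ ψ) := h1.continuous_fderiv (by simp)
  have hd : Differentiable ℝ ψ := h1.differentiable (by simp)
  set e : Euc n := -(‖h‖⁻¹ • h) with he
  have hen : ‖e‖ ≤ 1 := by
    rw [he, norm_neg, norm_smul, norm_inv, norm_norm]
    exact inv_mul_le_one
  have hhe : -h = ‖h‖ • e := by
    rcases eq_or_ne h 0 with rfl | hne
    · simp
    · rw [he, smul_neg, smul_inv_smul₀ (norm_ne_zero_iff.2 hne)]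
  have hD : ∀ t : ℝ, ∫ x in E, fderiv ℝ ψ (x - t • h) (-h) ≤ ‖h‖ * C := by
    intro t
    have c1 : ContDiff ℝ 1 (fun y => ψ (y - t • h)) := h1.comp (by fun_prop)
    have ha : Adm (fun y => ψ (y - t • h) • e) := by
      refine ⟨by fun_prop, ?_, fun x => ?_⟩
      · have : HasCompactSupport (fun y => ψ (y - t • h)) :=
          h2.comp_homeomorph (Homeomorph.subRight (t • h))
        refine this.mono ?_
        intro x hx hx'
        apply hx
        simp [hx']
      · rw [norm_smul]; exact mul_le_one₀ (h3 _) (norm_nonneg _) hen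
    have := hC _ ha
    have e1 : ∀ x, fderiv ℝ ψ (x - t • h) (-h) = ‖h‖ * divg (fun y => ψ (y - t • h) • e) x := by
      intro x
      rw [divg_smul c1 contDiff_const, fderiv_comp_sub, hhe]
      simp [divg]
    simp_rw [e1]
    rw [integral_const_mul]
    exact mul_le_mul_of_nonneg_left this (norm_nonneg _)
  have ftc : ∀ x, ψ (x - h) - ψ x = ∫ t in Ioc (0:ℝ) 1, fderiv ℝ ψ (x - t • h) (-h) := by
    intro x
    have hderiv : ∀ t : ℝ, HasDerivAt (fun t : ℝ => ψ (x - t • h)) (fderiv ℝ ψ (x - t • h) (-h)) t := by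
      intro t
      have : HasDerivAt (fun t : ℝ => x - t • h) (-h) t := by
        have := ((hasDerivAt_id t).smul_const h).const_sub x
        simpa using this
      exact (hd _).hasFDerivAt.comp_hasDerivAt t this
    have := intervalIntegral.integral_eq_sub_of_hasDerivAt (a := 0) (b := 1)
      (fun t _ => hderiv t) (Continuous.intervalIntegrable (by fun_prop) _ _)
    rw [intervalIntegral.integral_of_le zero_le_one] at this
    rw [this]; simp
  simp_rw [ftc]
  obtain ⟨M, hM⟩ := (h2.fderiv (𝕜 := ℝ)).exists_bound_of_continuous hcd
  obtain ⟨R, hR⟩ := (h2.fderiv (𝕜 := ℝ)).isCompact.isBounded.subset_closedBall 0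
  have hint : Integrable (Function.uncurry fun (x : Euc n) (t : ℝ) => fderiv ℝ ψ (x - t • h) (-h))
      ((volume.restrict E).prod (volume.restrict (Ioc (0:ℝ) 1))) := by
    have i1 : Integrable ((closedBall (0 : Euc n) (R + ‖h‖)).indicator (fun _ => M * ‖h‖))
        (volume.restrict E) := by
      refine Integrable.restrict ?_
      rw [integrable_indicator_iff measurableSet_closedBall]
      exact integrableOn_const (isCompact_closedBall _ _).measure_lt_top.ne
    have i2 : Integrable (fun _ : ℝ => (1:ℝ)) (volume.restrict (Ioc (0:ℝ) 1)) := by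
      exact integrable_const _
    refine (i1.mul_prod i2).mono' ?_ ?_
    · exact Continuous.aestronglyMeasurable (by simp only [Function.uncurry_def]; fun_prop)
    · have : ∀ᵐ p : Euc n × ℝ ∂((volume.restrict E).prod (volume.restrict (Ioc (0:ℝ) 1))),
          p.2 ∈ Ioc (0:ℝ) 1 :=
        Measure.quasiMeasurePreserving_snd.ae (ae_restrict_mem measurableSet_Ioc)
      filter_upwards [this] with p hp
      simp only [Function.uncurry, mul_one]
      by_cases hx : p.1 ∈ closedBall (0 : Euc n) (R + ‖h‖)
      · rw [indicator_of_mem hx]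
        refine (ContinuousLinearMap.le_opNorm _ _).trans ?_
        rw [norm_neg]
        exact mul_le_mul_of_nonneg_right (hM _) (norm_nonneg _)
      · rw [indicator_of_notMem hx]
        have : fderiv ℝ ψ (p.1 - p.2 • h) = 0 := by
          apply image_eq_zero_of_notMem_tsupport
          intro hm
          apply hx
          have h5 := hR hm
          rw [mem_closedBall_zero_iff] at h5 ⊢
          have h6 : ‖p.2 • h‖ ≤ ‖h‖ := by
            rw [norm_smul, Real.norm_of_nonneg hp.1.le]
            exact mul_le_of_le_one_left (norm_nonneg _) hp.2
          have h7 : p.1 = (p.1 - p.2 • h) + p.2 • h := by abel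
          calc ‖p.1‖ = ‖(p.1 - p.2 • h) + p.2 • h‖ := by rw [← h7]
            _ ≤ _ := (norm_add_le _ _).trans (by linarith)
        rw [this]; simp
  rw [integral_integral_swap hint]
  have hfin : ∫ t in Ioc (0:ℝ) 1, ‖h‖ * C = ‖h‖ * C := by simp
  rw [← hfin]
  refine integral_mono ?_ (integrable_const _) hD
  exact hint.integral_prod_right

/-- Large cutoff functions. -/
def cut (n k : ℕ) : ContDiffBump (0 : Euc n) where
  rIn := (k : ℝ) + 1
  rOut := (k : ℝ) + 2
  rIn_pos := by positivity
  rIn_lt_rOut := by linarith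

lemma chi_integrable {n : ℕ} {E : Set (Euc n)} (hE : MeasurableSet E) (hv : volume E ≠ ∞) :
    Integrable (chi E) := by
  have h : Integrable (fun _ : Euc n => (1:ℝ)) (volume.restrict E) := integrableOn_const hv
  exact (integrable_indicator_iff hE).2 h

lemma trans_est {n : ℕ} {E : Set (Euc n)} (hE : MeasurableSet E) (hv : volume E ≠ ∞)
    {C : ℝ} (hC : PB E C) (h : Euc n) : ∫ x, |chi E x - chi E (x + h)| ≤ ‖h‖ * C := by
  set σ : Euc n → ℝ := fun x => chi E (x + h) - chi E x with hσ
  have hχ := chi_meas hE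
  have hχi := chi_integrable hE hv
  have hσm : Measurable σ := by fun_prop
  have hσ1 : ∀ x, |σ x| ≤ 1 := by
    intro x
    simp only [hσ]
    rcases chi_cases E (x + h) with h1 | h1 <;> rcases chi_cases E x with h2 | h2 <;> simp [h1, h2]
  have hσi : Integrable σ := (hχi.comp_add_right h).sub hχi
  set ψ : ℕ → Euc n → ℝ := fun k x => (cut n k) x * moll k σ x with hψ
  have hψ1 : ∀ k, ContDiff ℝ 1 (ψ k) := fun k =>
    ((cut n k).contDiff).mul (moll_contDiff k hσm hσ1)
  have hψ2 : ∀ k, HasCompactSupport (ψ k) := fun k => (cut n k).hasCompactSupport.mul_right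
  have hψ3 : ∀ k x, |ψ k x| ≤ 1 := by
    intro k x
    simp only [hψ, abs_mul]
    refine mul_le_one₀ ?_ (abs_nonneg _) (moll_abs_le k hσ1 x)
    rw [abs_of_nonneg (cut n k).nonneg]
    exact (cut n k).le_one
  have key : ∀ k, ∫ x, σ x * ψ k x ≤ ‖h‖ * C := by
    intro k
    refine le_trans (le_of_eq ?_) (trans_smooth hC (hψ1 k) (hψ2 k) (hψ3 k) h)
    have hc := (hψ1 k).continuous
    have i1 : Integrable (fun x => chi E x * ψ k x) :=
      hχi.mul_bdd (c := 1) hc.aestronglyMeasurable (Eventually.of_forall (hψ3 k))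
    have i2 : Integrable (fun x => chi E x * ψ k (x - h)) :=
      hχi.mul_bdd (c := 1) (hc.comp (by fun_prop)).aestronglyMeasurable
        (Eventually.of_forall fun x => hψ3 k _)
    have i3 : Integrable (fun x => chi E (x + h) * ψ k x) := by
      have := i2.comp_add_right h
      simpa using this
    have e3 : ∫ x, chi E (x + h) * ψ k x = ∫ x, chi E x * ψ k (x - h) := by
      rw [← integral_add_right_eq_self (fun x => chi E x * ψ k (x - h)) h]
      simp
    rw [← chi_mul_int hE]
    simp_rw [hσ, sub_mul, mul_sub]
    rw [integral_sub i3 i1, integral_sub i2 i1, e3]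
  have hlim : Tendsto (fun k => ∫ x, σ x * ψ k x) atTop (nhds (∫ x, σ x * σ x)) := by
    refine tendsto_integral_of_dominated_convergence (fun x => ‖σ x‖) ?_ hσi.norm ?_ ?_
    · intro k
      exact (hσm.mul (hψ1 k).continuous.measurable).aestronglyMeasurable
    · intro k
      refine Eventually.of_forall fun x => ?_
      rw [norm_mul]
      exact mul_le_of_le_one_right (norm_nonneg _) (hψ3 k x)
    · filter_upwards [moll_tendsto hσm hσ1] with x hx
      refine Tendsto.const_mul _ ?_
      refine hx.congr' ?_
      obtain ⟨N, hN⟩ := exists_nat_ge ‖x‖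
      filter_upwards [eventually_ge_atTop N] with k hk
      simp only [hψ]
      rw [(cut n k).one_of_mem_closedBall, one_mul]
      rw [mem_closedBall_zero_iff]
      have : (N : ℝ) ≤ k := by exact_mod_cast hk
      simp only [cut]; linarith
  have e : ∀ x, |chi E x - chi E (x + h)| = σ x * σ x := by
    intro x
    simp only [hσ]
    rcases chi_cases E (x + h) with h1 | h1 <;> rcases chi_cases E x with h2 | h2 <;> simp [h1, h2]
  simp_rw [e]
  exact le_of_tendsto hlim (Eventually.of_forall key)

/-- The integrand of the fractional perimeter. -/
def fk (n : ℕ) (s : ℝ) (E : Set (Euc n)) (x y : Euc n) : ℝ :=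
  |chi E x - chi E y| / ‖x - y‖ ^ ((n : ℝ) + s)

/-- The fractional perimeter as a lower integral. -/
def PsL (n : ℕ) (s : ℝ) (E : Set (Euc n)) : ℝ≥0∞ :=
  ∫⁻ x, ∫⁻ y, ENNReal.ofReal (fk n s E x y)

lemma fk_nonneg {n : ℕ} (s : ℝ) (E : Set (Euc n)) (x y : Euc n) : 0 ≤ fk n s E x y := by
  unfold fk; positivity

lemma fk_meas {n : ℕ} (s : ℝ) {E : Set (Euc n)} (hE : MeasurableSet E) :
    Measurable (Function.uncurry (fk n s E)) := by
  have hχ := chi_meas hE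
  simp only [Function.uncurry_def, fk]
  fun_prop

lemma kernel_int {n : ℕ} (hn : 1 ≤ n) {s : ℝ} (hs : s ∈ Set.Ioo (0 : ℝ) 1) (V C : ℝ)
    (hV : 0 ≤ V) (hC : 0 ≤ C) :
    Integrable (fun h : Euc n => min V (‖h‖ * C) / ‖h‖ ^ ((n : ℝ) + s)) := by
  have : Nontrivial (Euc n) := by
    have : Nonempty (Fin n) := ⟨⟨0, hn⟩⟩
    infer_instance
  rw [integrable_fun_norm_addHaar (volume : Measure (Euc n))
    (f := fun r : ℝ => min V (r * C) / r ^ ((n : ℝ) + s))]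
  have hm : ∀ S : Set ℝ, AEStronglyMeasurable (fun y : ℝ => y ^ (Module.finrank ℝ (Euc n) - 1) •
      (min V (y * C) / y ^ ((n : ℝ) + s))) (volume.restrict S) := fun S =>
    Measurable.aestronglyMeasurable (by fun_prop)
  have hpow : ∀ y : ℝ, 0 < y → y ^ (Module.finrank ℝ (Euc n) - 1) •
      (min V (y * C) / y ^ ((n : ℝ) + s)) = min V (y * C) * y ^ (-1 - s) := by
    intro y hy
    have : (y ^ (Module.finrank ℝ (Euc n) - 1) : ℝ) = y ^ ((n : ℝ) - 1) := by
      rw [finrank_euclideanSpace, Fintype.card_fin, ← Real.rpow_natCast, Nat.cast_sub hn]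
      simp
    rw [this, smul_eq_mul, mul_div_assoc', mul_comm, mul_div_assoc, ← Real.rpow_sub hy]
    congr 2; ring
  have hnn : ∀ y : ℝ, 0 < y → 0 ≤ min V (y * C) * y ^ (-1 - s) := fun y hy =>
    mul_nonneg (le_min hV (by positivity)) (Real.rpow_nonneg hy.le _)
  rw [← Ioc_union_Ioi_eq_Ioi (zero_le_one (α := ℝ))]
  refine IntegrableOn.union ?_ ?_
  · have i1 : IntegrableOn (fun y : ℝ => C * y ^ (-s)) (Ioc 0 1) := by
      have := intervalIntegral.intervalIntegrable_rpow' (a := 0) (b := 1) (r := -s) (by linarith [hs.2])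
      rw [intervalIntegrable_iff_integrableOn_Ioc_of_le zero_le_one] at this
      exact this.const_mul C
    refine Integrable.mono' i1 (hm _) ?_
    filter_upwards [ae_restrict_mem measurableSet_Ioc] with y hy
    rw [hpow y hy.1, Real.norm_of_nonneg (hnn y hy.1)]
    calc min V (y * C) * y ^ (-1 - s) ≤ (y * C) * y ^ (-1 - s) :=
          mul_le_mul_of_nonneg_right (min_le_right _ _) (Real.rpow_nonneg hy.1.le _)
      _ = C * (y ^ (1:ℝ) * y ^ (-1 - s)) := by rw [Real.rpow_one]; ring
      _ = C * y ^ (-s) := by rw [← Real.rpow_add hy.1]; congr 2; ring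
  · have i1 : IntegrableOn (fun y : ℝ => V * y ^ (-1 - s)) (Ioi 1) :=
      (integrableOn_Ioi_rpow_of_lt (by linarith [hs.1]) one_pos).const_mul V
    refine Integrable.mono' i1 (hm _) ?_
    filter_upwards [ae_restrict_mem measurableSet_Ioi] with y hy
    have hy0 : 0 < y := lt_trans one_pos hy
    rw [hpow y hy0, Real.norm_of_nonneg (hnn y hy0)]
    exact mul_le_mul_of_nonneg_right (min_le_left _ _) (Real.rpow_nonneg hy0.le _)

lemma PsL_lt_top {n : ℕ} (hn : 1 ≤ n) {s : ℝ} (hs : s ∈ Set.Ioo (0 : ℝ) 1) {E : Set (Euc n)}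
    (hE : MeasurableSet E) (hv : volume E ≠ ∞) (hP : HasFinitePerim E) : PsL n s E < ∞ := by
  have hχ := chi_meas hE
  have hχi := chi_integrable hE hv
  have hC := PB_perim hP
  set C := perim E
  have hC0 : 0 ≤ C := perim_nonneg hP
  have hV : ∀ h, ∫ x, |chi E x - chi E (x + h)| ≤ (∫ x, chi E x) + ∫ x, chi E x := by
    intro h
    have e : ∫ x, chi E (x + h) = ∫ x, chi E x := integral_add_right_eq_self _ h
    have e2 : (∫ x, chi E x) + ∫ x, chi E x = ∫ x, (chi E x + chi E (x + h)) := by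
      rw [integral_add hχi (hχi.comp_add_right h), e]
    rw [e2]
    refine integral_mono (hχi.sub (hχi.comp_add_right h)).abs (hχi.add (hχi.comp_add_right h)) ?_
    intro x
    have h1 := chi_nonneg E x
    have h2 := chi_nonneg E (x + h)
    rw [abs_le]; constructor <;> linarith
  set V := (∫ x, chi E x) + ∫ x, chi E x
  have hV0 : 0 ≤ V := by
    have : 0 ≤ ∫ x, chi E x := integral_nonneg (chi_nonneg E)
    positivity
  have hmeas : Measurable (Function.uncurry fun x h : Euc n => ENNReal.ofReal (fk n s E x (x + h))) := by
    simp only [Function.uncurry_def, fk]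
    fun_prop
  have e1 : PsL n s E = ∫⁻ h, ∫⁻ x, ENNReal.ofReal (fk n s E x (x + h)) := by
    rw [lintegral_lintegral_swap hmeas.aemeasurable.prod_swap]
    unfold PsL
    congr 1; ext x
    exact (lintegral_add_left_eq_self (fun y => ENNReal.ofReal (fk n s E x y)) x).symm
  rw [e1]
  have hk := (kernel_int hn hs V C hV0 hC0).lintegral_lt_top
  refine lt_of_le_of_lt (lintegral_mono fun h => ?_) hk
  have e2 : ∀ x, fk n s E x (x + h) = |chi E x - chi E (x + h)| / ‖h‖ ^ ((n : ℝ) + s) := by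
    intro x
    simp [fk]
  simp_rw [e2]
  have hi : Integrable (fun x => |chi E x - chi E (x + h)| / ‖h‖ ^ ((n : ℝ) + s)) :=
    (hχi.sub (hχi.comp_add_right h)).abs.div_const _
  rw [← ofReal_integral_eq_lintegral_ofReal hi (Eventually.of_forall fun x => by positivity)]
  apply ENNReal.ofReal_le_ofReal
  rw [integral_div]
  gcongr
  exact le_min (hV h) (trans_est hE hv hC h)

lemma Ps_eq {n : ℕ} {s : ℝ} {E : Set (Euc n)}
    (hE : MeasurableSet E) (hfin : PsL n s E < ∞) : Ps n s E = (PsL n s E).toReal := by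
  have hm := fk_meas s hE
  have hn0 : 0 ≤ᵐ[volume.prod volume] Function.uncurry (fk n s E) :=
    Eventually.of_forall fun p => fk_nonneg s E p.1 p.2
  have hL : ∫⁻ p, ENNReal.ofReal (Function.uncurry (fk n s E) p) ∂(volume.prod volume) = PsL n s E := by
    rw [lintegral_prod _ (by fun_prop)]
    rfl
  have hi : Integrable (Function.uncurry (fk n s E)) (volume.prod volume) := by
    refine ⟨hm.aestronglyMeasurable, ?_⟩
    rw [hasFiniteIntegral_iff_ofReal hn0, hL]
    exact hfin
  have : Ps n s E = ∫ p, Function.uncurry (fk n s E) p ∂(volume.prod volume) := by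
    rw [integral_prod _ hi]; rfl
  rw [this, integral_eq_lintegral_of_nonneg_ae hn0
    hm.aestronglyMeasurable, hL]

lemma Ps_null {n : ℕ} {s : ℝ} {E : Set (Euc n)} (h : volume E = 0) : Ps n s E = 0 := by
  have h0 : ∀ᵐ x, chi E x = 0 := by
    have : ∀ᵐ x, x ∉ E := measure_eq_zero_iff_ae_notMem.1 h
    filter_upwards [this] with x hx
    simp [chi, hx]
  unfold Ps
  apply integral_eq_zero_of_ae
  filter_upwards [h0] with x hx
  apply integral_eq_zero_of_ae
  filter_upwards [h0] with y hy
  simp [hx, hy]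

lemma tail_small {n : ℕ} {E : Set (Euc n)} (hE : MeasurableSet E) (hv : volume E ≠ ∞)
    {δ : ℝ≥0∞} (hδ : 0 < δ) : ∃ N : ℕ, ∀ r : ℝ, (N : ℝ) ≤ r → volume (E \ ball 0 r) ≤ δ := by
  have h1 : Tendsto (fun N : ℕ => volume (E \ ball (0 : Euc n) N)) atTop
      (nhds (volume (⋂ N : ℕ, E \ ball (0 : Euc n) N))) := by
    refine tendsto_measure_iInter_atTop
      (fun N => (hE.diff measurableSet_ball).nullMeasurableSet) ?_ ⟨0, ?_⟩
    · intro a b hab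
      exact sdiff_subset_sdiff_right (ball_subset_ball (by exact_mod_cast hab))
    · exact measure_ne_top_of_subset sdiff_subset hv
  have h2 : (⋂ N : ℕ, E \ ball (0 : Euc n) N) = ∅ := by
    rw [eq_empty_iff_forall_notMem]
    intro x hx
    rw [mem_iInter] at hx
    obtain ⟨N, hN⟩ := exists_nat_gt ‖x‖
    exact (hx N).2 (by simpa using hN)
  rw [h2, measure_empty] at h1
  obtain ⟨N, hN⟩ := (h1.eventually (gt_mem_nhds hδ)).exists
  exact ⟨N, fun r hr => (measure_mono (sdiff_subset_sdiff_right (ball_subset_ball hr))).trans hN.le⟩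

lemma fatou_step {n : ℕ} {s : ℝ} {A B : Set (Euc n)} {F : ℕ → Set (Euc n)}
    (hF : ∀ k, MeasurableSet (F k)) {r : ℕ → ℝ} {x : ℕ → Euc n} (hr : ∀ k : ℕ, (k : ℝ) ≤ r k)
    (hx : ∀ k, 2 * r k ≤ ‖x k‖)
    (hA : ∀ᵐ y, ∀ᶠ k in atTop, chi (F k) y = chi A y)
    (hB : ∀ᵐ y, ∀ᶠ k in atTop, chi (F k) (y + x k) = chi B y)
    (hAm : MeasurableSet A) (hBm : MeasurableSet B) :
    PsL n s A + PsL n s B ≤ liminf (fun k => PsL n s (F k)) atTop := by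
  set f : Set (Euc n) → Euc n × Euc n → ℝ≥0∞ := fun E p => ENNReal.ofReal (fk n s E p.1 p.2) with hf
  have hfm : ∀ {E : Set (Euc n)}, MeasurableSet E → Measurable (f E) := fun hE =>
    (fk_meas s hE).ennreal_ofReal
  have hL : ∀ {E : Set (Euc n)}, MeasurableSet E → PsL n s E = ∫⁻ p, f E p ∂(volume.prod volume) := by
    intro E hE
    rw [lintegral_prod _ (hfm hE).aemeasurable]; rfl
  set Q : ℕ → Set (Euc n × Euc n) := fun k => ball 0 (r k) ×ˢ ball 0 (r k) with hQ
  have hQm : ∀ k, MeasurableSet (Q k) := fun k => measurableSet_ball.prod measurableSet_ball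
  set H : ℕ → Euc n × Euc n → ℝ≥0∞ := fun k =>
    (Q k).indicator (fun p => f (F k) p + f (F k) (p + (x k, x k))) with hH
  have hHm : ∀ k, Measurable (H k) := fun k =>
    ((hfm (hF k)).add ((hfm (hF k)).comp (by fun_prop))).indicator (hQm k)
  have hle : ∀ k, ∫⁻ p, H k p ∂(volume.prod volume) ≤ PsL n s (F k) := by
    intro k
    rw [hL (hF k)]
    set Q' : Set (Euc n × Euc n) := (fun p => p - (x k, x k)) ⁻¹' (Q k) with hQ'
    have hQ'm : MeasurableSet Q' := (hQm k).preimage (by fun_prop)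
    have e1 : ∫⁻ p, H k p ∂(volume.prod volume) =
        ∫⁻ p, (Q k).indicator (f (F k)) p ∂(volume.prod volume) +
        ∫⁻ p, (Q k).indicator (fun p => f (F k) (p + (x k, x k))) p ∂(volume.prod volume) := by
      rw [← lintegral_add_left ((hfm (hF k)).indicator (hQm k))]
      congr 1; ext p
      by_cases hp : p ∈ Q k <;> simp [hH, hp]
    have e2 : ∫⁻ p, (Q k).indicator (fun p => f (F k) (p + (x k, x k))) p ∂(volume.prod volume) =
        ∫⁻ p, Q'.indicator (f (F k)) p ∂(volume.prod volume) := by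
      rw [← lintegral_add_right_eq_self (fun p => Q'.indicator (f (F k)) p) (x k, x k)]
      congr 1; ext p
      by_cases hp : p ∈ Q k
      · have : p + (x k, x k) ∈ Q' := by simpa [hQ'] using hp
        rw [indicator_of_mem hp, indicator_of_mem this]
      · have : p + (x k, x k) ∉ Q' := by simpa [hQ'] using hp
        rw [indicator_of_notMem hp, indicator_of_notMem this]
    rw [e1, e2, ← lintegral_add_left ((hfm (hF k)).indicator (hQm k))]
    refine lintegral_mono fun p => ?_
    by_cases hp : p ∈ Q k
    · have : p ∉ Q' := by
        intro hp'
        have a1 : ‖p.1‖ < r k := by simpa using hp.1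
        have a2 : ‖p.1 - x k‖ < r k := by simpa using hp'.1
        have a3 : ‖x k‖ ≤ ‖p.1‖ + ‖p.1 - x k‖ := by
          have : x k = p.1 - (p.1 - x k) := by abel
          calc ‖x k‖ = ‖p.1 - (p.1 - x k)‖ := by rw [← this]
            _ ≤ _ := norm_sub_le _ _
        linarith [hx k]
      simp [hp, this]
    · simp only [indicator_of_notMem hp, zero_add]
      exact indicator_le_self _ _ _
  have hlim : ∀ᵐ p ∂((volume : Measure (Euc n)).prod volume),
      liminf (fun k => H k p) atTop = f A p + f B p := by
    have a1 := (Measure.quasiMeasurePreserving_fst (μ := (volume : Measure (Euc n)))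
      (ν := (volume : Measure (Euc n)))).ae hA
    have a2 := (Measure.quasiMeasurePreserving_snd (μ := (volume : Measure (Euc n)))
      (ν := (volume : Measure (Euc n)))).ae hA
    have b1 := (Measure.quasiMeasurePreserving_fst (μ := (volume : Measure (Euc n)))
      (ν := (volume : Measure (Euc n)))).ae hB
    have b2 := (Measure.quasiMeasurePreserving_snd (μ := (volume : Measure (Euc n)))
      (ν := (volume : Measure (Euc n)))).ae hB
    filter_upwards [a1, a2, b1, b2] with p a1 a2 b1 b2
    apply Tendsto.liminf_eq
    apply tendsto_const_nhds.congr'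
    obtain ⟨N, hN⟩ := exists_nat_gt (max ‖p.1‖ ‖p.2‖)
    filter_upwards [a1, a2, b1, b2, eventually_ge_atTop N] with k a1 a2 b1 b2 hk
    have hNk : (N : ℝ) ≤ r k := le_trans (by exact_mod_cast hk) (hr k)
    have hp : p ∈ Q k := by
      refine ⟨?_, ?_⟩
      · simpa using lt_of_le_of_lt (le_max_left _ _) (hN.trans_le hNk)
      · simpa using lt_of_le_of_lt (le_max_right _ _) (hN.trans_le hNk)
    simp only [hH, indicator_of_mem hp, hf, fk, Prod.fst_add, Prod.snd_add, a1, a2, b1, b2,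
      add_sub_add_right_eq_sub]
  rw [hL hAm, hL hBm, ← lintegral_add_left (hfm hAm), ← lintegral_congr_ae hlim]
  refine (lintegral_liminf_le hHm).trans ?_
  exact liminf_le_liminf (Eventually.of_forall hle)

lemma seq_exists {n : ℕ} (hn : 1 ≤ n) {s : ℝ} {A B : Set (Euc n)} (hA : MeasurableSet A)
    (hB : MeasurableSet B) (hvA : volume A ≠ ∞) (hvB : volume B ≠ ∞)
    (hPA : HasFinitePerim A) (hPB : HasFinitePerim B) :
    ∃ F : ℕ → Set (Euc n), (∀ k, MeasurableSet (F k)) ∧ (∀ k, PB (F k) (perim A + perim B)) ∧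
      (∀ k, volume (F k) ≤ volume A + volume B) ∧
      (∀ k, volume A + volume B ≤ volume (F k) + 2 * (2⁻¹ : ℝ≥0∞) ^ k) ∧
      PsL n s A + PsL n s B ≤ liminf (fun k => PsL n s (F k)) atTop := by
  have hδ : ∀ k : ℕ, 0 < (2⁻¹ : ℝ≥0∞) ^ k := fun k => ENNReal.pow_pos (by simp) k
  have hex : ∀ k : ℕ, ∃ r : ℝ, (k : ℝ) ≤ r ∧ volume (A \ ball 0 r) ≤ (2⁻¹ : ℝ≥0∞) ^ k ∧
      volume (B \ ball 0 r) ≤ (2⁻¹ : ℝ≥0∞) ^ k := by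
    intro k
    obtain ⟨N, hN⟩ := tail_small hA hvA (hδ k)
    obtain ⟨M, hM⟩ := tail_small hB hvB (hδ k)
    exact ⟨max (k : ℝ) (max N M), le_max_left _ _,
      hN _ ((le_max_left _ _).trans (le_max_right _ _)),
      hM _ ((le_max_right _ _).trans (le_max_right _ _))⟩
  choose r hr hrA hrB using hex
  have hr0 : ∀ k, 0 ≤ r k := fun k => le_trans (Nat.cast_nonneg k) (hr k)
  set x : ℕ → Euc n := fun k => EuclideanSpace.single ⟨0, hn⟩ (2 * r k) with hx
  have hxn : ∀ k, ‖x k‖ = 2 * r k := by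
    intro k
    simp [hx, abs_of_nonneg (hr0 k)]
  set T : ℕ → Set (Euc n) := fun k => (fun y => (1:ℝ) • y + (-x k)) ⁻¹' B with hT
  have hTm : ∀ k, MeasurableSet (T k) := fun k => hB.preimage (by fun_prop)
  have hTv : ∀ k, volume (T k) = volume B := by
    intro k
    rw [hT, volume_aff B one_pos]; simp
  have hTP : ∀ k, PB (T k) (perim B) := by
    intro k
    have := (PB_perim hPB).aff hn hB one_pos (-x k)
    simpa [hT] using this
  have memT : ∀ k y, y ∈ T k ↔ y - x k ∈ B := by
    intro k y; simp [hT, sub_eq_add_neg]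
  have big : ∀ k y, ‖y‖ < r k → r k ≤ ‖y - x k‖ ∧ r k ≤ ‖y + x k‖ := by
    intro k y hy
    have h1 := hxn k
    have h2 : ‖x k‖ - ‖y‖ ≤ ‖x k + y‖ := by
      have := norm_sub_le (x k + y) y
      rw [add_sub_cancel_right] at this; linarith
    have h3 : ‖x k‖ - ‖y‖ ≤ ‖x k - y‖ := norm_sub_norm_le _ _
    rw [norm_sub_rev, add_comm y]
    constructor <;> linarith
  have hS : ∀ k, volume (T k ∩ ball 0 (r k)) ≤ (2⁻¹ : ℝ≥0∞) ^ k := by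
    intro k
    have : T k ∩ ball 0 (r k) ⊆ (fun y => (1:ℝ) • y + (-x k)) ⁻¹' (B \ ball 0 (r k)) := by
      rintro y ⟨h1, h2⟩
      refine ⟨h1, ?_⟩
      have h3 := (big k y (by simpa using h2)).1
      simpa [← sub_eq_add_neg] using h3
    refine (measure_mono this).trans ?_
    rw [volume_aff _ one_pos]
    simpa using hrB k
  have hS' : ∀ k, volume ((fun y => (1:ℝ) • y + x k) ⁻¹' A ∩ ball 0 (r k)) ≤ (2⁻¹ : ℝ≥0∞) ^ k := by
    intro k
    have : (fun y => (1:ℝ) • y + x k) ⁻¹' A ∩ ball 0 (r k) ⊆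
        (fun y => (1:ℝ) • y + x k) ⁻¹' (A \ ball 0 (r k)) := by
      rintro y ⟨h1, h2⟩
      refine ⟨h1, ?_⟩
      have h3 := (big k y (by simpa using h2)).2
      simpa using h3
    refine (measure_mono this).trans ?_
    rw [volume_aff _ one_pos]
    simpa using hrA k
  have hsum : ∑' k : ℕ, (2⁻¹ : ℝ≥0∞) ^ k ≠ ∞ := by
    rw [ENNReal.tsum_geometric]
    simp
  have inball : ∀ y : Euc n, ∀ᶠ k in atTop, y ∈ ball 0 (r k) := by
    intro y
    obtain ⟨N, hN⟩ := exists_nat_gt ‖y‖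
    filter_upwards [eventually_ge_atTop N] with k hk
    have hNk : (N : ℝ) ≤ r k := le_trans (by exact_mod_cast hk) (hr k)
    simpa using hN.trans_le hNk
  have ae1 : ∀ᵐ y, ∀ᶠ k in atTop, y ∉ T k ∩ ball 0 (r k) :=
    ae_eventually_notMem (ne_top_of_le_ne_top hsum (ENNReal.tsum_le_tsum hS))
  have ae2 : ∀ᵐ y, ∀ᶠ k in atTop, y ∉ (fun y => (1:ℝ) • y + x k) ⁻¹' A ∩ ball 0 (r k) :=
    ae_eventually_notMem (ne_top_of_le_ne_top hsum (ENNReal.tsum_le_tsum hS'))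
  refine ⟨fun k => A ∪ T k, fun k => hA.union (hTm k),
    fun k => (PB_perim hPA).union hA (hTm k) (hTP k), fun k => ?_, fun k => ?_, ?_⟩
  · exact (measure_union_le _ _).trans (by rw [hTv])
  · rw [← hTv k, ← measure_union_add_inter A (hTm k)]
    gcongr
    have : A ∩ T k ⊆ (A \ ball 0 (r k)) ∪ (T k ∩ ball 0 (r k)) := by
      rintro y ⟨h1, h2⟩
      by_cases h : y ∈ ball 0 (r k)
      · exact Or.inr ⟨h2, h⟩
      · exact Or.inl ⟨h1, h⟩
    refine (measure_mono this).trans ((measure_union_le _ _).trans ?_)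
    rw [two_mul]
    exact add_le_add (hrA k) (hS k)
  · refine fatou_step (fun k => hA.union (hTm k)) hr (fun k => (hxn k).ge) ?_ ?_ hA hB
    · filter_upwards [ae1] with y hy
      filter_upwards [hy, inball y] with k h1 h2
      have : y ∉ T k := fun h => h1 ⟨h, h2⟩
      by_cases hyA : y ∈ A <;> simp [chi, hyA, this]
    · filter_upwards [ae2] with y hy
      filter_upwards [hy, inball y] with k h1 h2
      have h3 : y + x k ∉ A := fun h => h1 ⟨by simpa using h, h2⟩
      have h4 : y + x k ∈ T k ↔ y ∈ B := by rw [memT]; simp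
      by_cases hyB : y ∈ B <;> simp [chi, hyB, h3, h4]

lemma Fen_null {n : ℕ} {s α : ℝ} {E : Set (Euc n)} (h : volume E = 0) : Fen n s α E = 0 := by
  have h1 := PB_null h
  have h2 : perim E = 0 := le_antisymm h1.le (perim_nonneg h1.fin)
  simp [Fen, h2, Ps_null h]

lemma vol_scale {n : ℕ} (hn : 1 ≤ n) {E : Set (Euc n)} {v w : ℝ} (hv : 0 < v) (hw : 0 < w)
    (hE : volume E = ENNReal.ofReal v) (b : Euc n) :
    volume ((fun y => ((v / w) ^ ((1:ℝ) / n)) • y + b) ⁻¹' E) = ENNReal.ofReal w := by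
  have hn0 : (n : ℝ) ≠ 0 := by positivity
  rw [volume_aff E (by positivity), hE, ← ENNReal.ofReal_mul (by positivity)]
  congr 1
  rw [← Real.rpow_natCast, ← Real.rpow_mul (by positivity), one_div_mul_cancel hn0, Real.rpow_one]
  field_simp

lemma combine {n : ℕ} (hn : 1 ≤ n) {s : ℝ} (hs : s ∈ Set.Ioo (0 : ℝ) 1) {α : ℝ} (hα : 0 < α)
    {A B : Set (Euc n)} (hA : MeasurableSet A)
    (hB : MeasurableSet B) (hvA : volume A ≠ ∞) (hvB : volume B ≠ ∞)
    (hPA : HasFinitePerim A) (hPB : HasFinitePerim B) {ε : ℝ} (hε : 0 < ε) :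
    ∃ C : Set (Euc n), MeasurableSet C ∧ HasFinitePerim C ∧ volume C = volume A + volume B ∧
      Fen n s α C ≤ Fen n s α A + Fen n s α B + ε := by
  by_cases h0 : volume A + volume B = 0
  · have hA0 : volume A = 0 := by simp at h0; exact h0.1
    have hB0 : volume B = 0 := by simp at h0; exact h0.2
    exact ⟨A, hA, hPA, by simp [hA0, hB0], by rw [Fen_null hA0, Fen_null hB0]; linarith⟩
  obtain ⟨F, hFm, hFP, hFv, hFv', hFL⟩ := seq_exists hn (s := s) hA hB hvA hvB hPA hPB
  have hvne : volume A + volume B ≠ ∞ := ENNReal.add_ne_top.2 ⟨hvA, hvB⟩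
  set w : ℝ := (volume A + volume B).toReal with hw
  have hwpos : 0 < w := ENNReal.toReal_pos h0 hvne
  have hFt : ∀ k, volume (F k) ≠ ∞ := fun k => ne_top_of_le_ne_top hvne (hFv k)
  set v : ℕ → ℝ := fun k => (volume (F k)).toReal with hv
  have hvw : ∀ k, v k ≤ w := fun k => ENNReal.toReal_mono hvne (hFv k)
  have hwv : ∀ k, w ≤ v k + 2 * (2⁻¹ : ℝ) ^ k := by
    intro k
    have h1 : (volume (F k) + 2 * (2⁻¹ : ℝ≥0∞) ^ k) ≠ ∞ := by
      refine ENNReal.add_ne_top.2 ⟨hFt k, ENNReal.mul_ne_top (by simp) (ENNReal.pow_ne_top (by simp))⟩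
    have h2 := ENNReal.toReal_mono h1 (hFv' k)
    rw [ENNReal.toReal_add (hFt k) (ENNReal.mul_ne_top (by simp) (ENNReal.pow_ne_top (by simp)))] at h2
    simpa using h2
  have hvt : Tendsto v atTop (nhds w) := by
    have h1 : Tendsto (fun k : ℕ => w - 2 * (2⁻¹ : ℝ) ^ k) atTop (nhds w) := by
      have := ((tendsto_pow_atTop_nhds_zero_of_lt_one (r := (2⁻¹ : ℝ)) (by norm_num)
        (by norm_num)).const_mul 2).const_sub w
      simpa using this
    exact tendsto_of_tendsto_of_tendsto_of_le_of_le h1 tendsto_const_nhds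
      (fun k => by have := hwv k; simp only; linarith) hvw
  set a : ℕ → ℝ := fun k => (v k / w) ^ ((1:ℝ) / n) with ha
  have hat : Tendsto a atTop (nhds 1) := by
    have h1 : Tendsto (fun k => v k / w) atTop (nhds 1) := by
      have := hvt.div_const w
      rwa [div_self hwpos.ne'] at this
    have := h1.rpow_const (p := (1:ℝ) / n) (Or.inl one_ne_zero)
    rwa [Real.one_rpow] at this
  have hPt : Tendsto (fun k => ((a k) ^ (n - 1))⁻¹ * (perim A + perim B)) atTop
      (nhds (perim A + perim B)) := by
    have := ((hat.pow (n - 1)).inv₀ (by simp)).mul_const (perim A + perim B)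
    simpa using this
  have hβ : 0 < α * s * (1 - s) := mul_pos (mul_pos hα hs.1) (by linarith [hs.2])
  set β := α * s * (1 - s) with hβdef
  set δ := ε / 2 / β with hδ
  have hδ0 : 0 < δ := by positivity
  have hβδ : β * δ = ε / 2 := by rw [hδ]; field_simp
  have hAt := PsL_lt_top hn hs hA hvA hPA
  have hBt := PsL_lt_top hn hs hB hvB hPB
  have hFt' : ∀ k, PsL n s (F k) < ∞ := fun k => PsL_lt_top hn hs (hFm k) (hFt k) (hFP k).fin
  have hPs : ∀ᶠ k in atTop, Ps n s A + Ps n s B - δ ≤ Ps n s (F k) := by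
    by_cases hneg : Ps n s A + Ps n s B - δ < 0
    · refine Eventually.of_forall fun k => hneg.le.trans ?_
      rw [Ps_eq (hFm k) (hFt' k)]; positivity
    · push Not at hneg
      have hsum : PsL n s A + PsL n s B = ENNReal.ofReal (Ps n s A + Ps n s B) := by
        rw [Ps_eq hA hAt, Ps_eq hB hBt, ← ENNReal.toReal_add hAt.ne hBt.ne,
          ENNReal.ofReal_toReal (ENNReal.add_ne_top.2 ⟨hAt.ne, hBt.ne⟩)]
      have hlt : ENNReal.ofReal (Ps n s A + Ps n s B - δ) < liminf (fun k => PsL n s (F k)) atTop := by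
        refine lt_of_lt_of_le ?_ hFL
        rw [hsum]
        exact (ENNReal.ofReal_lt_ofReal_iff_of_nonneg hneg).2 (by linarith)
      filter_upwards [eventually_lt_of_lt_liminf hlt] with k hk
      rw [Ps_eq (hFm k) (hFt' k)]
      exact (ENNReal.ofReal_le_iff_le_toReal (hFt' k).ne).1 hk.le
  obtain ⟨k, hk1, hk2, hk3⟩ := (hPs.and ((hPt.eventually (gt_mem_nhds
    (show perim A + perim B < perim A + perim B + ε / 2 by linarith))).and
    (hvt.eventually (lt_mem_nhds hwpos)))).exists
  have hak : 0 < a k := Real.rpow_pos_of_pos (div_pos hk3 hwpos) _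
  have hak1 : a k ≤ 1 := Real.rpow_le_one (div_pos hk3 hwpos).le
    ((div_le_one hwpos).2 (hvw k)) (by positivity)
  have hPBk := (hFP k).aff hn (hFm k) hak 0
  refine ⟨(fun y => a k • y + 0) ⁻¹' F k, (hFm k).preimage (by fun_prop), hPBk.fin, ?_, ?_⟩
  · rw [ha, vol_scale hn hk3 hwpos (ENNReal.ofReal_toReal (hFt k)).symm 0, hw,
      ENNReal.ofReal_toReal hvne]
  · unfold Fen
    rw [Ps_aff s (F k) hak 0]
    have hn1 : (1:ℝ) ≤ n := by exact_mod_cast hn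
    have h1 : 1 ≤ (a k) ^ (s - n) := Real.one_le_rpow_of_pos_of_le_one_of_nonpos hak hak1
      (by linarith [hs.2])
    have h2 : 0 ≤ Ps n s (F k) := by rw [Ps_eq (hFm k) (hFt' k)]; positivity
    have h3 : Ps n s (F k) ≤ (a k) ^ (s - n) * Ps n s (F k) := le_mul_of_one_le_left h2 h1
    have h4 : β * (Ps n s A + Ps n s B - δ) ≤ β * ((a k) ^ (s - n) * Ps n s (F k)) :=
      mul_le_mul_of_nonneg_left (hk1.trans h3) hβ.le
    have h5 := hPBk.le
    rw [mul_sub, hβδ] at h4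
    simp only [← hβdef]
    linarith

lemma combine_fam {n : ℕ} (hn : 1 ≤ n) {s : ℝ} (hs : s ∈ Set.Ioo (0 : ℝ) 1) {α : ℝ} (hα : 0 < α)
    {ε : ℝ} (hε : 0 < ε) (N : ℕ) (𝔽 : Fin N → Set (Euc n)) (h : FamOK 𝔽) :
    ∃ C : Set (Euc n), MeasurableSet C ∧ HasFinitePerim C ∧ volume C = famVol 𝔽 ∧
      Fen n s α C ≤ GenF n s α 𝔽 + N * ε := by
  induction N with
  | zero =>
    have h0 : volume (∅ : Set (Euc n)) = 0 := measure_empty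
    exact ⟨∅, MeasurableSet.empty, (PB_null h0).fin, by simp [famVol], by
      rw [Fen_null h0]; simp [GenF]⟩
  | succ N ih =>
    obtain ⟨D, hD1, hD2, hD3, hD4⟩ := ih (fun i => 𝔽 i.castSucc) (fun i => h _)
    have hDt : volume D ≠ ∞ := by
      rw [hD3]
      exact ENNReal.sum_ne_top.2 fun i _ => (h _).2.2
    obtain ⟨C, hC1, hC2, hC3, hC4⟩ := combine hn hs hα hD1 (h (Fin.last N)).1 hDt
      (h (Fin.last N)).2.2 hD2 (h (Fin.last N)).2.1 hε
    refine ⟨C, hC1, hC2, ?_, ?_⟩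
    · rw [hC3, hD3, famVol, famVol, Fin.sum_univ_castSucc]
    · have : GenF n s α 𝔽 = GenF n s α (fun i => 𝔽 i.castSucc) + Fen n s α (𝔽 (Fin.last N)) := by
        rw [GenF, GenF, Fin.sum_univ_castSucc]
      rw [this]; push_cast; linarith

lemma interp {n : ℕ} (hn : 1 ≤ n) {s : ℝ} (hs : s ∈ Set.Ioo (0 : ℝ) 1)
    {μ : ℝ} (hμ : 0 < μ)
    (hμdef : μ⁻¹ = sInf {r : ℝ | ∃ E : Set (Euc n), MeasurableSet E ∧ HasFinitePerim E ∧
      volume E = ENNReal.ofReal 1 ∧ r = perim E ^ s / (s * (1 - s) * Ps n s E)})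
    {E : Set (Euc n)} (hE : MeasurableSet E) (hP : HasFinitePerim E) {v : ℝ} (hv : 0 < v)
    (hEv : volume E = ENNReal.ofReal v) :
    s * (1 - s) * Ps n s E ≤ μ * perim E ^ s * v ^ (1 - s) := by
  have hss : 0 < s * (1 - s) := mul_pos hs.1 (by linarith [hs.2])
  have hPsnn : ∀ E : Set (Euc n), 0 ≤ Ps n s E := fun E =>
    integral_nonneg fun x => integral_nonneg fun y => by positivity
  have hbdd : BddBelow {r : ℝ | ∃ E : Set (Euc n), MeasurableSet E ∧ HasFinitePerim E ∧
      volume E = ENNReal.ofReal 1 ∧ r = perim E ^ s / (s * (1 - s) * Ps n s E)} := by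
    refine ⟨0, ?_⟩
    rintro r ⟨D, _, hD, _, rfl⟩
    exact div_nonneg (Real.rpow_nonneg (perim_nonneg hD) _) (mul_nonneg hss.le (hPsnn D))
  have hn0 : (n : ℝ) ≠ 0 := by positivity
  set a : ℝ := (v / 1) ^ ((1:ℝ) / n) with ha
  have hapos : 0 < a := by positivity
  have han : a ^ (n : ℝ) = v := by
    rw [ha, ← Real.rpow_mul (by positivity), one_div_mul_cancel hn0, Real.rpow_one, div_one]
  have hPB := (PB_perim hP).aff hn hE hapos 0
  have hvol := vol_scale hn hv one_pos hEv 0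
  set D := (fun y => a • y + 0) ⁻¹' E with hD
  have hinf : μ⁻¹ ≤ perim D ^ s / (s * (1 - s) * Ps n s D) := by
    rw [hμdef]
    exact csInf_le hbdd ⟨D, hE.preimage (by fun_prop), hPB.fin, hvol, rfl⟩
  have hPsD : Ps n s D = a ^ (s - n) * Ps n s E := Ps_aff s E hapos 0
  have hPD : perim D ≤ a ^ (1 - (n:ℝ)) * perim E := by
    have := hPB.le
    have e : (a ^ (n - 1))⁻¹ = a ^ (1 - (n:ℝ)) := by
      rw [← Real.rpow_natCast, Nat.cast_sub hn, ← Real.rpow_neg hapos.le]; simp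
    rwa [e] at this
  have h1 : s * (1 - s) * Ps n s D ≤ μ * perim D ^ s := by
    rcases eq_or_lt_of_le (hPsnn D) with h0 | h0
    · rw [← h0]; simp
      exact mul_nonneg hμ.le (Real.rpow_nonneg (perim_nonneg hPB.fin) _)
    · rw [le_div_iff₀ (mul_pos hss h0), inv_mul_le_iff₀ hμ] at hinf
      exact hinf
  have h2 : perim D ^ s ≤ a ^ ((1 - (n:ℝ)) * s) * perim E ^ s := by
    rw [Real.rpow_mul hapos.le, ← Real.mul_rpow (Real.rpow_nonneg hapos.le _) (perim_nonneg hP)]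
    exact Real.rpow_le_rpow (perim_nonneg hPB.fin) hPD hs.1.le
  have h3 : Ps n s E = a ^ ((n:ℝ) - s) * Ps n s D := by
    rw [hPsD, ← mul_assoc, ← Real.rpow_add hapos]; simp
  have h4 : v ^ (1 - s) = a ^ ((n:ℝ) - s) * a ^ ((1 - (n:ℝ)) * s) := by
    rw [← han, ← Real.rpow_mul hapos.le, ← Real.rpow_add hapos]; congr 1; ring
  have hp : 0 < a ^ ((n:ℝ) - s) := Real.rpow_pos_of_pos hapos _
  calc s * (1 - s) * Ps n s E = a ^ ((n:ℝ) - s) * (s * (1 - s) * Ps n s D) := by rw [h3]; ring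
    _ ≤ a ^ ((n:ℝ) - s) * (μ * (a ^ ((1 - (n:ℝ)) * s) * perim E ^ s)) := by
      refine mul_le_mul_of_nonneg_left (h1.trans ?_) hp.le
      exact mul_le_mul_of_nonneg_left h2 hμ.le
    _ = _ := by rw [h4]; ring

/-- The limit constant. -/
def cc (s γ : ℝ) : ℝ := (1 - s) * s ^ (s / (1 - s)) * γ ^ ((1 : ℝ) / (1 - s))

lemma young {s : ℝ} (hs : s ∈ Set.Ioo (0 : ℝ) 1) {γ P v : ℝ} (hγ : 0 < γ) (hP : 0 ≤ P)
    (hv : 0 ≤ v) : -cc s γ * v ≤ P - γ * P ^ s * v ^ (1 - s) := by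
  have hs0 := hs.1
  have hs1 : 0 < 1 - s := by linarith [hs.2]
  set Y : ℝ := s ^ (s / (1 - s)) * γ ^ ((1 : ℝ) / (1 - s)) with hY
  have hY0 : 0 < Y := mul_pos (Real.rpow_pos_of_pos hs0 _) (Real.rpow_pos_of_pos hγ _)
  have h := Real.geom_mean_le_arith_mean2_weighted hs0.le hs1.le (p₁ := P / s) (p₂ := Y * v)
    (by positivity) (by positivity) (by ring)
  have e1 : Y ^ (1 - s) = s ^ s * γ := by
    rw [hY, Real.mul_rpow (by positivity) (by positivity), ← Real.rpow_mul hs0.le,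
      ← Real.rpow_mul hγ.le, div_mul_cancel₀ _ hs1.ne', one_div_mul_cancel hs1.ne', Real.rpow_one]
  have e2 : (P / s) ^ s * (Y * v) ^ (1 - s) = γ * P ^ s * v ^ (1 - s) := by
    rw [Real.div_rpow hP hs0.le, Real.mul_rpow hY0.le hv, e1]
    have : s ^ s ≠ 0 := (Real.rpow_pos_of_pos hs0 _).ne'
    field_simp
  rw [e2, mul_div_cancel₀ _ hs0.ne'] at h
  have : cc s γ = (1 - s) * Y := by rw [cc, hY]; ring
  rw [this]; linarith

/-- The optimal ratio between perimeter and volume. -/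
lemma opt {s : ℝ} (hs : s ∈ Set.Ioo (0 : ℝ) 1) {γ : ℝ} (hγ : 0 < γ) :
    ∃ t : ℝ, 0 < t ∧ t - γ * t ^ s = -cc s γ := by
  have hs0 := hs.1
  have hs1 : 0 < 1 - s := by linarith [hs.2]
  refine ⟨(γ * s) ^ ((1:ℝ) / (1 - s)), by positivity, ?_⟩
  set t := (γ * s) ^ ((1:ℝ) / (1 - s)) with ht
  have e1 : γ * t ^ s = t / s := by
    have h1 : t = t ^ s * t ^ (1 - s) := by
      rw [← Real.rpow_add (by positivity)]; simp
    have h2 : t ^ (1 - s) = γ * s := by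
      rw [ht, ← Real.rpow_mul (by positivity), one_div_mul_cancel hs1.ne', Real.rpow_one]
    rw [h2] at h1
    rw [eq_div_iff hs0.ne']
    linarith
  have e2 : t = s * s ^ (s / (1 - s)) * γ ^ ((1 : ℝ) / (1 - s)) := by
    rw [ht, Real.mul_rpow hγ.le hs0.le]
    have : (1:ℝ) / (1 - s) = 1 + s / (1 - s) := by field_simp; ring
    nth_rw 2 [this]
    rw [Real.rpow_add hs0, Real.rpow_one]; ring
  rw [e1, cc, e2]
  field_simp
  ring

lemma Fen_lower {n : ℕ} (hn : 1 ≤ n) {s : ℝ} (hs : s ∈ Set.Ioo (0 : ℝ) 1) {α : ℝ} (hα : 0 < α)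
    {μ : ℝ} (hμ : 0 < μ)
    (hμdef : μ⁻¹ = sInf {r : ℝ | ∃ E : Set (Euc n), MeasurableSet E ∧ HasFinitePerim E ∧
      volume E = ENNReal.ofReal 1 ∧ r = perim E ^ s / (s * (1 - s) * Ps n s E)})
    {E : Set (Euc n)} (hE : MeasurableSet E) (hP : HasFinitePerim E) (hv : volume E ≠ ∞) :
    -cc s (α * μ) * (volume E).toReal ≤ Fen n s α E := by
  by_cases h0 : volume E = 0
  · rw [Fen_null h0, h0]; simp
  have hvpos : 0 < (volume E).toReal := ENNReal.toReal_pos h0 hv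
  have h1 := interp hn hs hμ hμdef hE hP hvpos (ENNReal.ofReal_toReal hv).symm
  have h2 := young hs (mul_pos hα hμ) (perim_nonneg hP) hvpos.le
  refine h2.trans ?_
  unfold Fen
  have := mul_le_mul_of_nonneg_left h1 hα.le
  have e : α * s * (1 - s) * Ps n s E = α * (s * (1 - s) * Ps n s E) := by ring
  rw [e]
  have e' : α * μ * perim E ^ s * (volume E).toReal ^ (1 - s) =
    α * (μ * perim E ^ s * (volume E).toReal ^ (1 - s)) := by ring
  rw [e']; linarith

lemma GenF_lower {n : ℕ} (hn : 1 ≤ n) {s : ℝ} (hs : s ∈ Set.Ioo (0 : ℝ) 1) {α : ℝ} (hα : 0 < α)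
    {μ : ℝ} (hμ : 0 < μ)
    (hμdef : μ⁻¹ = sInf {r : ℝ | ∃ E : Set (Euc n), MeasurableSet E ∧ HasFinitePerim E ∧
      volume E = ENNReal.ofReal 1 ∧ r = perim E ^ s / (s * (1 - s) * Ps n s E)})
    {m : ℝ} (hm : 0 < m) {N : ℕ} (𝔽 : Fin N → Set (Euc n)) (h : FamOK 𝔽)
    (hv : famVol 𝔽 = ENNReal.ofReal m) : -cc s (α * μ) * m ≤ GenF n s α 𝔽 := by
  have e : m = ∑ i, (volume (𝔽 i)).toReal := by
    rw [← ENNReal.toReal_sum (fun i _ => (h i).2.2)]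
    have : (famVol 𝔽).toReal = m := by rw [hv, ENNReal.toReal_ofReal hm.le]
    exact this.symm
  rw [e, Finset.mul_sum]
  exact Finset.sum_le_sum fun i _ => Fen_lower hn hs hα hμ hμdef (h i).1 (h i).2.1 (h i).2.2

lemma infG_upper {n : ℕ} (hn : 1 ≤ n) {s : ℝ} (hs : s ∈ Set.Ioo (0 : ℝ) 1) {α : ℝ} (hα : 0 < α)
    {μ : ℝ} (hμ : 0 < μ)
    (hμdef : μ⁻¹ = sInf {r : ℝ | ∃ E : Set (Euc n), MeasurableSet E ∧ HasFinitePerim E ∧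
      volume E = ENNReal.ofReal 1 ∧ r = perim E ^ s / (s * (1 - s) * Ps n s E)})
    {ε : ℝ} (hε : 0 < ε) : ∀ᶠ m : ℝ in atTop, infG n s α m / m < -cc s (α * μ) + ε := by
  have hss : 0 < s * (1 - s) := mul_pos hs.1 (by linarith [hs.2])
  obtain ⟨t, ht0, ht⟩ := opt hs (mul_pos hα hμ)
  have hts : 0 < t ^ s := Real.rpow_pos_of_pos ht0 _
  obtain ⟨q, hq0, hqμ, hq⟩ : ∃ q : ℝ, 0 < q ∧ q < μ ∧ t - α * q * t ^ s < -cc s (α * μ) + ε := by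
    have hc : Tendsto (fun q : ℝ => t - α * q * t ^ s) (nhdsWithin μ (Iio μ))
        (nhds (t - α * μ * t ^ s)) := by
      refine Tendsto.mono_left ?_ nhdsWithin_le_nhds
      exact Continuous.tendsto (by fun_prop) μ
    have h1 := hc.eventually (gt_mem_nhds (show t - α * μ * t ^ s < -cc s (α * μ) + ε by
      rw [ht]; linarith))
    have h2 : ∀ᶠ q in nhdsWithin μ (Iio μ), 0 < q := nhdsWithin_le_nhds (lt_mem_nhds hμ)
    obtain ⟨q, h1, h2, h3⟩ := (h1.and (h2.and self_mem_nhdsWithin)).exists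
    exact ⟨q, h2, h3, h1⟩
  have hne : {r : ℝ | ∃ E : Set (Euc n), MeasurableSet E ∧ HasFinitePerim E ∧
      volume E = ENNReal.ofReal 1 ∧ r = perim E ^ s / (s * (1 - s) * Ps n s E)}.Nonempty := by
    by_contra hem
    rw [not_nonempty_iff_eq_empty] at hem
    rw [hem, Real.sInf_empty] at hμdef
    exact (inv_pos.2 hμ).ne' hμdef
  obtain ⟨_, ⟨E, hE, hP, hEv, rfl⟩, hr⟩ := exists_lt_of_csInf_lt hne
    (show _ < q⁻¹ by rw [← hμdef]; exact (inv_lt_inv₀ hμ hq0).2 hqμ)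
  have hPsnn : ∀ E : Set (Euc n), 0 ≤ Ps n s E := fun E =>
    integral_nonneg fun x => integral_nonneg fun y => by positivity
  have hbdd : BddBelow {r : ℝ | ∃ E : Set (Euc n), MeasurableSet E ∧ HasFinitePerim E ∧
      volume E = ENNReal.ofReal 1 ∧ r = perim E ^ s / (s * (1 - s) * Ps n s E)} := by
    refine ⟨0, ?_⟩
    rintro r ⟨D, _, hD, _, rfl⟩
    exact div_nonneg (Real.rpow_nonneg (perim_nonneg hD) _) (mul_nonneg hss.le (hPsnn D))
  have hrpos : 0 < perim E ^ s / (s * (1 - s) * Ps n s E) :=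
    lt_of_lt_of_le (inv_pos.2 hμ) (by rw [hμdef]; exact csInf_le hbdd ⟨E, hE, hP, hEv, rfl⟩)
  have hPs0 : 0 < s * (1 - s) * Ps n s E := by
    rcases eq_or_lt_of_le (hPsnn E) with h0 | h0
    · rw [← h0] at hrpos; simp at hrpos
    · exact mul_pos hss h0
  have hP0 : 0 < perim E := by
    rcases eq_or_lt_of_le (perim_nonneg hP) with h0 | h0
    · rw [← h0, Real.zero_rpow hs.1.ne'] at hrpos; simp at hrpos
    · exact h0
  have hqP : q * perim E ^ s ≤ s * (1 - s) * Ps n s E := by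
    rw [div_lt_iff₀ hPs0, lt_inv_mul_iff₀ hq0] at hr
    exact hr.le
  set P := perim E with hPdef
  have hn0 : (n : ℝ) ≠ 0 := by positivity
  set b : ℝ := (t / P) ^ (n : ℝ) with hb
  have hb0 : 0 < b := Real.rpow_pos_of_pos (div_pos ht0 hP0) _
  set a : ℝ → ℝ := fun m => (1 / (m / (⌊b * m⌋₊ : ℝ))) ^ ((1:ℝ) / n) with ha
  have hat : Tendsto (fun m => a m * P) atTop (nhds t) := by
    have h1 : Tendsto (fun m : ℝ => (1 / (m / (⌊b * m⌋₊ : ℝ)))) atTop (nhds b) := by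
      have := tendsto_nat_floor_mul_div_atTop (R := ℝ) hb0.le
      simpa only [one_div, inv_div] using this
    have h2 := (h1.rpow_const (p := (1:ℝ) / n) (Or.inl hb0.ne')).mul_const P
    have e : b ^ ((1:ℝ) / n) * P = t := by
      rw [hb, ← Real.rpow_mul (div_pos ht0 hP0).le, mul_one_div_cancel hn0, Real.rpow_one,
        div_mul_cancel₀ _ hP0.ne']
    rwa [e] at h2
  have hbr : Tendsto (fun m => a m * P - α * q * (a m * P) ^ s) atTop
      (nhds (t - α * q * t ^ s)) :=
    hat.sub ((hat.rpow_const (Or.inl ht0.ne')).const_mul _)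
  filter_upwards [hbr.eventually (gt_mem_nhds hq), eventually_gt_atTop 0,
    eventually_ge_atTop (1 / b)] with m hm1 hm0 hmb
  have hN1 : 1 ≤ ⌊b * m⌋₊ := by
    rw [Nat.one_le_floor_iff]
    rwa [div_le_iff₀' hb0] at hmb
  set N := ⌊b * m⌋₊ with hN
  have hNpos : (0:ℝ) < N := by exact_mod_cast hN1
  have hw : 0 < m / N := div_pos hm0 hNpos
  have ham : 0 < a m := Real.rpow_pos_of_pos (by positivity) _
  have hvol := vol_scale hn one_pos hw hEv 0
  have hPBD := (PB_perim hP).aff hn hE ham 0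
  have hPsD := Ps_aff s E ham 0
  have hD : MeasurableSet ((fun y => a m • y + 0) ⁻¹' E) := hE.preimage (by fun_prop)
  have hvol' : volume ((fun y => a m • y + 0) ⁻¹' E) = ENNReal.ofReal (m / N) := hvol
  set D := (fun y => a m • y + 0) ⁻¹' E with hDdef
  have han : a m ^ (-(n:ℝ)) = m / N := by
    have : a m = (1 / (m / (N : ℝ))) ^ ((1:ℝ) / n) := rfl
    rw [Real.rpow_neg ham.le, this, ← Real.rpow_mul (by positivity), one_div_mul_cancel hn0,
      Real.rpow_one]
    field_simp
  have hFen : Fen n s α D ≤ m / N * (a m * P - α * q * (a m * P) ^ s) := by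
    unfold Fen
    rw [hPsD]
    have e1 : (a m ^ (n - 1))⁻¹ = m / N * a m := by
      rw [← han]
      nth_rw 3 [← Real.rpow_one (a m)]
      rw [← Real.rpow_add ham, ← Real.rpow_natCast, ← Real.rpow_neg ham.le, Nat.cast_sub hn]
      congr 1; push_cast; ring
    have e2 : a m ^ (s - n) = m / N * a m ^ s := by
      rw [← han, ← Real.rpow_add ham]; congr 1; ring
    have h1 := hPBD.le
    rw [e1] at h1
    rw [e2, Real.mul_rpow ham.le hP0.le]
    have h3 : α * (m / N * a m ^ s) * (q * P ^ s) ≤ α * (m / N * a m ^ s) * (s * (1 - s) * Ps n s E) :=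
      mul_le_mul_of_nonneg_left hqP
        (mul_nonneg hα.le (mul_nonneg hw.le (Real.rpow_nonneg ham.le _)))
    linarith
  have hmem : GenF n s α (fun _ : Fin N => D) ∈ {r : ℝ | ∃ (N : ℕ) (𝔽 : Fin N → Set (Euc n)),
      FamOK 𝔽 ∧ famVol 𝔽 = ENNReal.ofReal m ∧ r = GenF n s α 𝔽} := by
    refine ⟨N, fun _ => D, fun _ => ⟨hD, hPBD.fin, by rw [hvol']; simp⟩, ?_, rfl⟩
    simp only [famVol, hvol', Finset.sum_const, Finset.card_univ, Fintype.card_fin]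
    rw [← ENNReal.ofReal_nsmul]
    congr 1
    rw [nsmul_eq_mul]; field_simp
  have hbG : BddBelow {r : ℝ | ∃ (N : ℕ) (𝔽 : Fin N → Set (Euc n)),
      FamOK 𝔽 ∧ famVol 𝔽 = ENNReal.ofReal m ∧ r = GenF n s α 𝔽} := by
    refine ⟨-cc s (α * μ) * m, ?_⟩
    rintro r ⟨M, 𝔽, h1, h2, rfl⟩
    exact GenF_lower hn hs hα hμ hμdef hm0 𝔽 h1 h2
  have hle : infG n s α m ≤ GenF n s α (fun _ : Fin N => D) := csInf_le hbG hmem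
  rw [div_lt_iff₀ hm0]
  refine hle.trans_lt ?_
  have e3 : GenF n s α (fun _ : Fin N => D) = N * Fen n s α D := by
    simp [GenF]
  rw [e3]
  calc (N : ℝ) * Fen n s α D ≤ N * (m / N * (a m * P - α * q * (a m * P) ^ s)) :=
        mul_le_mul_of_nonneg_left hFen hNpos.le
    _ = (a m * P - α * q * (a m * P) ^ s) * m := by field_simp
    _ < _ := mul_lt_mul_of_pos_right hm1 hm0

/-- asymptotics of the minimal energy:
`inf_{|F|=m} F_{s,α} = inf_{|𝔽|=m} G_{s,α} = -(1-s) s^{s/(1-s)} (α μ_{n,s})^{1/(1-s)} m + o(m)`. -/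
theorem stmt_8 (n : ℕ) (hn : 2 ≤ n) (s : ℝ) (hs : s ∈ Set.Ioo (0 : ℝ) 1)
    (α : ℝ) (hα : 0 < α) (μ : ℝ) (hμ : 0 < μ)
    (hμdef : μ⁻¹ = sInf {r : ℝ | ∃ E : Set (Euc n), MeasurableSet E ∧ HasFinitePerim E ∧
      volume E = ENNReal.ofReal 1 ∧ r = perim E ^ s / (s * (1 - s) * Ps n s E)}) :
    (∀ m : ℝ, 0 < m → infF n s α m = infG n s α m) ∧
      Filter.Tendsto (fun m : ℝ => infF n s α m / m) Filter.atTop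
        (nhds (-((1 - s) * s ^ (s / (1 - s)) * (α * μ) ^ ((1 : ℝ) / (1 - s))))) ∧
      Filter.Tendsto (fun m : ℝ => infG n s α m / m) Filter.atTop
        (nhds (-((1 - s) * s ^ (s / (1 - s)) * (α * μ) ^ ((1 : ℝ) / (1 - s))))) := by
  have hn1 : 1 ≤ n := by omega
  have hlowG : ∀ m : ℝ, 0 < m → ∀ r ∈ {r : ℝ | ∃ (N : ℕ) (𝔽 : Fin N → Set (Euc n)),
      FamOK 𝔽 ∧ famVol 𝔽 = ENNReal.ofReal m ∧ r = GenF n s α 𝔽}, -cc s (α * μ) * m ≤ r := by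
    rintro m hm r ⟨M, 𝔽, h1, h2, rfl⟩
    exact GenF_lower hn1 hs hα hμ hμdef hm 𝔽 h1 h2
  have hsub : ∀ m : ℝ, {r : ℝ | ∃ F : Set (Euc n), MeasurableSet F ∧ HasFinitePerim F ∧
      volume F = ENNReal.ofReal m ∧ r = Fen n s α F} ⊆ {r : ℝ | ∃ (N : ℕ) (𝔽 : Fin N → Set (Euc n)),
      FamOK 𝔽 ∧ famVol 𝔽 = ENNReal.ofReal m ∧ r = GenF n s α 𝔽} := by
    rintro m r ⟨F, h1, h2, h3, rfl⟩
    exact ⟨1, fun _ => F, fun _ => ⟨h1, h2, by rw [h3]; simp⟩, by simp [famVol, h3], by simp [GenF]⟩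
  have hne : ∀ m : ℝ, 0 < m → {r : ℝ | ∃ F : Set (Euc n), MeasurableSet F ∧ HasFinitePerim F ∧
      volume F = ENNReal.ofReal m ∧ r = Fen n s α F}.Nonempty := by
    intro m hm
    have : {r : ℝ | ∃ E : Set (Euc n), MeasurableSet E ∧ HasFinitePerim E ∧
      volume E = ENNReal.ofReal 1 ∧ r = perim E ^ s / (s * (1 - s) * Ps n s E)}.Nonempty := by
      by_contra hem
      rw [not_nonempty_iff_eq_empty] at hem
      rw [hem, Real.sInf_empty] at hμdef
      exact (inv_pos.2 hμ).ne' hμdef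
    obtain ⟨_, E, hE, hP, hEv, _⟩ := this
    exact ⟨_, _, hE.preimage (by fun_prop),
      ((PB_perim hP).aff hn1 hE (Real.rpow_pos_of_pos (div_pos one_pos hm) _) 0).fin,
      vol_scale hn1 one_pos hm hEv 0, rfl⟩
  have heq : ∀ m : ℝ, 0 < m → infF n s α m = infG n s α m := by
    intro m hm
    apply le_antisymm
    · refine le_csInf ((hne m hm).mono (hsub m)) ?_
      rintro r ⟨N, 𝔽, h1, h2, rfl⟩
      refine le_of_forall_pos_le_add fun ε hε => ?_
      have hN : (0:ℝ) < (N : ℝ) + 1 := by positivity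
      obtain ⟨C, hC1, hC2, hC3, hC4⟩ := combine_fam hn1 hs hα (div_pos hε hN) N 𝔽 h1
      have h5 : infF n s α m ≤ Fen n s α C :=
        csInf_le ⟨-cc s (α * μ) * m, fun r hr => hlowG m hm r (hsub m hr)⟩
          ⟨C, hC1, hC2, hC3.trans h2, rfl⟩
      have h6 : (N : ℝ) * (ε / (N + 1)) ≤ ε := by
        rw [mul_div_assoc', div_le_iff₀ hN]; nlinarith
      linarith
    · exact csInf_le_csInf ⟨-cc s (α * μ) * m, hlowG m hm⟩ (hne m hm) (hsub m)
  have hG : Filter.Tendsto (fun m : ℝ => infG n s α m / m) Filter.atTop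
        (nhds (-cc s (α * μ))) := by
    rw [Metric.tendsto_nhds]
    intro ε hε
    filter_upwards [infG_upper hn1 hs hα hμ hμdef hε, eventually_gt_atTop 0] with m h1 hm
    have h2 : -cc s (α * μ) * m ≤ infG n s α m :=
      le_csInf ((hne m hm).mono (hsub m)) (hlowG m hm)
    rw [← le_div_iff₀ hm] at h2
    rw [Real.dist_eq, abs_lt]
    constructor <;> linarith
  refine ⟨heq, ?_, hG⟩
  refine Tendsto.congr' ?_ hG
  filter_upwards [eventually_gt_atTop 0] with m hm
  rw [heq m hm]
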